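/- If two non-circular standard weighted graphs Gamma and Gamma' are birationally equivalent, then there is a graph isomorphism from Gamma to Gamma' mapping branching points to branching points such that for every linear segment of Gamma of type [[0_{2k},w_1,...,w_n]] the image segment of Gamma' has weight sequence [[0_{2k},w_1,...,w_n]] or its reversion [[0_{2k},w_n,...,w_1]]; in other words, a non-circular standard weighted graph is unique in its birational equivalence class up to reversions of its linear segments and changing the weights of its branching vertices. -/

import Mathlib

/-- A weighted graph: a finite simple graph on a finite set of natural-number
vertices, with an integer weight attached to each vertex. -/
structure WGraph where
  verts : Finset ℕ
  adj : ℕ → ℕ → Bool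
  symm : ∀ u v, adj u v = true → adj v u = true
  loopless : ∀ v, adj v v = false
  support : ∀ u v, adj u v = true → u ∈ verts ∧ v ∈ verts
  wt : ℕ → ℤ

namespace WGraph

/-- The degree of a vertex. -/
def deg (G : WGraph) (v : ℕ) : ℕ := (G.verts.filter (fun u => G.adj v u = true)).card

/-- A branching point: a vertex of degree at least `3`. -/
def Branch (G : WGraph) (v : ℕ) : Prop := v ∈ G.verts ∧ 3 ≤ G.deg v

/-- The graph is connected (and nonempty). -/
def Connected (G : WGraph) : Prop :=
  G.verts.Nonempty ∧ ∀ u ∈ G.verts, ∀ v ∈ G.verts,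
    Relation.ReflTransGen (fun a b => G.adj a b = true) u v

/-- A circular graph: a nonempty connected graph all of whose vertices have degree `2`,
i.e. a cycle. -/
def IsCircular (G : WGraph) : Prop :=
  G.verts.Nonempty ∧ G.Connected ∧ ∀ v ∈ G.verts, G.deg v = 2

/-- The set of non-branching vertices. -/
def NB (G : WGraph) : Set ℕ := {v | v ∈ G.verts ∧ G.deg v < 3}

/-- A linear segment: a connected component of the graph obtained by deleting
the branching points. -/
def IsSegment (G : WGraph) (S : Set ℕ) : Prop :=
  ∃ v ∈ G.NB, S = {u | Relation.ReflTransGen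
    (fun a b => a ∈ G.NB ∧ b ∈ G.NB ∧ G.adj a b = true) v u}

/-- `l` is a consecutive enumeration of the linear segment `S`. -/
def SegList (G : WGraph) (S : Set ℕ) (l : List ℕ) : Prop :=
  l.Nodup ∧ (∀ v, v ∈ l ↔ v ∈ S) ∧ l.Chain' (fun a b => G.adj a b = true)

/-- A standard weight sequence: all weights zero, or an even number `2k ≥ 0` of zeros
followed by weights `≤ -2`. -/
def StdSeq (m : List ℤ) : Prop :=
  (∀ x ∈ m, x = 0) ∨
  ∃ (k : ℕ) (ws : List ℤ), m = List.replicate (2 * k) 0 ++ ws ∧ ∀ x ∈ ws, x ≤ -2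

/-- A standard weighted graph: connected, and every linear segment, enumerated
consecutively starting (when the segment is adjacent to exactly one branching point)
from the vertex adjacent to that branching point, has a standard weight sequence. -/
def IsStandard (G : WGraph) : Prop :=
  G.Connected ∧
  ∀ S, G.IsSegment S → ∃ l, G.SegList S l ∧ StdSeq (l.map G.wt) ∧
    ∀ b, G.Branch b → (∃ v ∈ S, G.adj b v = true) →
      (∀ b', G.Branch b' → (∃ v' ∈ S, G.adj b' v' = true) → b' = b) →
      ∃ v0, l.head? = some v0 ∧ G.adj b v0 = true

/-- `G'` is obtained from `G` by the inner blowup at the edge `uv`, creating the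
new vertex `x`: the edge `uv` is deleted, `x` gets weight `-1` and is joined to
`u` and `v`, and the weights of `u` and `v` drop by `1`. -/
def IsInnerBlowup (G G' : WGraph) (u v x : ℕ) : Prop :=
  G.adj u v = true ∧ x ∉ G.verts ∧
  G'.verts = insert x G.verts ∧
  (∀ a b, G'.adj a b = true ↔
    ((G.adj a b = true ∧ ¬(a = u ∧ b = v) ∧ ¬(a = v ∧ b = u)) ∨
     (a = x ∧ (b = u ∨ b = v)) ∨ (b = x ∧ (a = u ∨ a = v)))) ∧
  (∀ a, G'.wt a = if a = x then -1 else if a = u then G.wt a - 1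
    else if a = v then G.wt a - 1 else G.wt a)

/-- `G'` is obtained from `G` by the outer blowup at the vertex `v`, creating the
new vertex `x` of weight `-1` joined only to `v`; the weight of `v` drops by `1`. -/
def IsOuterBlowup (G G' : WGraph) (v x : ℕ) : Prop :=
  v ∈ G.verts ∧ x ∉ G.verts ∧
  G'.verts = insert x G.verts ∧
  (∀ a b, G'.adj a b = true ↔
    (G.adj a b = true ∨ (a = x ∧ b = v) ∨ (b = x ∧ a = v))) ∧
  (∀ a, G'.wt a = if a = x then -1 else if a = v then G.wt a - 1 else G.wt a)

/-- A single blowup. -/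
def BlowupStep (G G' : WGraph) : Prop :=
  (∃ u v x, IsInnerBlowup G G' u v x) ∨ (∃ v x, IsOuterBlowup G G' v x)

/-- A single blowup or blowdown (a blowdown being the inverse of a blowup). -/
def Move (G G' : WGraph) : Prop := BlowupStep G G' ∨ BlowupStep G' G

/-- A weight-preserving isomorphism of weighted graphs. -/
def WIso (G G' : WGraph) : Prop :=
  ∃ f : ℕ → ℕ, Set.BijOn f (G.verts : Set ℕ) (G'.verts : Set ℕ) ∧
    (∀ u ∈ G.verts, ∀ v ∈ G.verts, G'.adj (f u) (f v) = G.adj u v) ∧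
    (∀ v ∈ G.verts, G'.wt (f v) = G.wt v)

/-- Birational equivalence of weighted graphs: the equivalence relation generated by
blowups, blowdowns and weight-preserving isomorphisms. -/
def BirEq : WGraph → WGraph → Prop :=
  Relation.EqvGen (fun G G' => Move G G' ∨ WIso G G')

end WGraph



set_option linter.all false

namespace WG

abbrev HH := Matrix.SpecialLinearGroup (Fin 2) ℤ × Multiplicative ℤ

def T : HH := (⟨!![1, 1; 0, 1], by simp⟩, Multiplicative.ofAdd 1)
def S : HH := (⟨!![0, 1; -1, 0], by simp⟩, Multiplicative.ofAdd 3)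

def eA (a : HH) : ℤ := a.1.1 0 0
def eB (a : HH) : ℤ := a.1.1 0 1
def eC (a : HH) : ℤ := a.1.1 1 0
def eD (a : HH) : ℤ := a.1.1 1 1
def eE (a : HH) : ℤ := Multiplicative.toAdd a.2

lemma hh_ext {a b : HH} (h00 : eA a = eA b) (h01 : eB a = eB b)
    (h10 : eC a = eC b) (h11 : eD a = eD b) (hd : eE a = eE b) : a = b := by
  apply Prod.ext
  · apply Subtype.ext
    ext i j
    fin_cases i <;> fin_cases j <;> assumption
  · exact hd

lemma T_zpow (n : ℤ) : (T ^ n).1.1 = !![1, n; 0, 1] ∧ Multiplicative.toAdd (T ^ n).2 = n := by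
  have h : T.1 = ModularGroup.T := by
    apply Subtype.ext
    simp [T, ModularGroup.T]
  constructor
  · have := ModularGroup.coe_T_zpow n
    rw [← this, ← h]
    rfl
  · simp [T]

@[simp] lemma Tz00 (n : ℤ) : eA (T ^ n) = 1 := by rw [eA, (T_zpow n).1]; rfl
@[simp] lemma Tz01 (n : ℤ) : eB (T ^ n) = n := by rw [eB, (T_zpow n).1]; rfl
@[simp] lemma Tz10 (n : ℤ) : eC (T ^ n) = 0 := by rw [eC, (T_zpow n).1]; rfl
@[simp] lemma Tz11 (n : ℤ) : eD (T ^ n) = 1 := by rw [eD, (T_zpow n).1]; rfl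
@[simp] lemma Tzd (n : ℤ) : eE (T ^ n) = n := (T_zpow n).2
@[simp] lemma one00 : eA 1 = 1 := rfl
@[simp] lemma one01 : eB 1 = 0 := rfl
@[simp] lemma one10 : eC 1 = 0 := rfl
@[simp] lemma one11 : eD 1 = 1 := rfl
@[simp] lemma oned : eE 1 = 0 := rfl
@[simp] lemma S00 : eA S = 0 := by simp [S, eA]
@[simp] lemma S01 : eB S = 1 := by simp [S, eB]
@[simp] lemma S10 : eC S = -1 := by simp [S, eC]
@[simp] lemma S11 : eD S = 0 := by simp [S, eD]
@[simp] lemma Sd : eE S = 3 := rfl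
lemma m00 (a b : HH) : eA (a * b) = eA a * eA b + eB a * eC b := by
  simp [eA, eB, eC, eD, Matrix.mul_apply, Fin.sum_univ_two]
lemma m01 (a b : HH) : eB (a * b) = eA a * eB b + eB a * eD b := by
  simp [eA, eB, eC, eD, Matrix.mul_apply, Fin.sum_univ_two]
lemma m10 (a b : HH) : eC (a * b) = eC a * eA b + eD a * eC b := by
  simp [eA, eB, eC, eD, Matrix.mul_apply, Fin.sum_univ_two]
lemma m11 (a b : HH) : eD (a * b) = eC a * eB b + eD a * eD b := by
  simp [eA, eB, eC, eD, Matrix.mul_apply, Fin.sum_univ_two]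
lemma md (a b : HH) : eE (a * b) = eE a + eE b := rfl

lemma rel : T * S * T = S * T⁻¹ * S := by
  have : T ^ (1 : ℤ) * S * T ^ (1 : ℤ) = S * T ^ (-1 : ℤ) * S := by
    apply hh_ext <;> simp only [m00, m01, m10, m11, md, Tz00, Tz01, Tz10, Tz11, Tzd,
      S00, S01, S10, S11, Sd] <;> norm_num
  simpa using this

lemma TS_inj {m i j : ℤ} (h : T ^ m * S * T ^ i = S * T ^ j) : m = 0 := by
  have := congrArg (eA) h
  simpa [m00, m01, m10, m11] using this

/-- anti-transpose -/
def rho (a : HH) : HH :=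
  (⟨!![eD a, eB a; eC a, eA a], by
    have := a.1.2
    rw [Matrix.det_fin_two] at this
    rw [Matrix.det_fin_two]
    simp [eA, eB, eC, eD]
    linarith⟩, a.2)

@[simp] lemma rho00 (a : HH) : eA (rho a) = eD a := rfl
@[simp] lemma rho01 (a : HH) : eB (rho a) = eB a := rfl
@[simp] lemma rho10 (a : HH) : eC (rho a) = eC a := rfl
@[simp] lemma rho11 (a : HH) : eD (rho a) = eA a := rfl
@[simp] lemma rhod (a : HH) : eE (rho a) = eE a := rfl

lemma rho_mul (a b : HH) : rho (a * b) = rho b * rho a := by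
  apply hh_ext <;> simp only [m00, m01, m10, m11, md, rho00, rho01, rho10, rho11, rhod] <;> ring
@[simp] lemma rho_T (n : ℤ) : rho (T ^ n) = T ^ n := by
  apply hh_ext <;> simp
@[simp] lemma rho_S : rho S = S := by
  apply hh_ext <;> simp
@[simp] lemma rho_rho (a : HH) : rho (rho a) = a := by
  apply hh_ext <;> simp

lemma SS_comm (a : HH) : S * S * a = a * (S * S) := by
  apply hh_ext <;> simp [m00, m01, m10, m11, md] <;> ring

/-- label of a list of weights -/
def lab : List ℤ → HH
  | [] => S
  | w :: ws => S * T ^ w * lab ws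

lemma lab_append (a : List ℤ) (w : ℤ) (b : List ℤ) :
    lab (a ++ w :: b) = lab a * T ^ w * lab b := by
  induction a with
  | nil => simp [lab]
  | cons x a ih => simp [lab, ih, mul_assoc]

lemma rho_lab (a : List ℤ) : rho (lab a) = lab a.reverse := by
  induction a with
  | nil => simp [lab]
  | cons x a ih => 
    rw [List.reverse_cons, lab_append, ← ih]
    simp [lab, rho_mul, mul_assoc]

lemma lab_zeros_left (k : ℕ) (ws : List ℤ) :
    lab (List.replicate (2 * k) 0 ++ ws) = (S * S) ^ k * lab ws := by
  induction k with
  | zero => simp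
  | succ k ih =>
    rw [show 2 * (k + 1) = 2 * k + 1 + 1 by ring, List.replicate_succ, List.replicate_succ]
    simp only [List.cons_append, lab, ih, zpow_zero, mul_one]
    rw [pow_succ']; simp [mul_assoc]

lemma SSpow_comm (k : ℕ) (a : HH) : (S * S) ^ k * a = a * (S * S) ^ k :=
  (Commute.pow_left (SS_comm a) k)

lemma lab_zeros_right (k : ℕ) (ws : List ℤ) :
    lab (ws ++ List.replicate (2 * k) 0) = (S * S) ^ k * lab ws := by
  have : ws ++ List.replicate (2 * k) 0 = (List.replicate (2 * k) 0 ++ ws.reverse).reverse := by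
    simp
  rw [this, ← rho_lab, lab_zeros_left, rho_mul, rho_lab, List.reverse_reverse]
  rw [SSpow_comm]
  congr 1
  clear this
  induction k with
  | zero => apply hh_ext <;> simp
  | succ k ih => rw [pow_succ', rho_mul, rho_mul, rho_S, ih, SSpow_comm]

lemma SSpow (k : ℕ) : eA ((S * S) ^ k) = (-1) ^ k ∧ eB ((S * S) ^ k) = 0 ∧
    eC ((S * S) ^ k) = 0 ∧ eD ((S * S) ^ k) = (-1) ^ k ∧
    eE ((S * S) ^ k) = 6 * k := by
  induction k with
  | zero => simp
  | succ k ih =>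
    obtain ⟨h1, h2, h3, h4, h5⟩ := ih
    simp only [pow_succ, m00, m01, m10, m11, md, h1, h2, h3, h4, h5]
    simp
    ring

/-- first column of labels of sequences ≤ -2 -/
lemma lab_neg (ws : List ℤ) (h : ∀ x ∈ ws, x ≤ -2) :
    0 ≤ -eA (lab ws) ∧ -eA (lab ws) < -eC (lab ws) := by
  induction ws with
  | nil => simp [lab]
  | cons w ws ih =>
    have h1 := ih (fun x hx => h x (by simp [hx]))
    have h2 := h w (by simp)
    simp only [lab, m00, m01, m10, m11, S00, S01, S10, S11, Tz00, Tz01, Tz10, Tz11]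
    constructor
    · linarith
    · nlinarith

lemma lab_col_inj (ws ws' : List ℤ) (h : ∀ x ∈ ws, x ≤ -2) (h' : ∀ x ∈ ws', x ≤ -2)
    (h0 : eA (lab ws) = eA (lab ws')) (h1 : eC (lab ws) = eC (lab ws')) :
    ws = ws' := by
  induction ws generalizing ws' with
  | nil =>
    cases ws' with
    | nil => rfl
    | cons w ws' =>
      have h2 := lab_neg ws' (fun x hx => h' x (by simp [hx]))
      simp only [lab, m00, m01, m10, m11, S00, S01, S10, S11, Tz00, Tz01, Tz10, Tz11] at *
      exfalso; linarith
  | cons w ws ih =>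
    have h3 := lab_neg ws (fun x hx => h x (by simp [hx]))
    cases ws' with
    | nil =>
      simp only [lab, m00, m01, m10, m11, S00, S01, S10, S11, Tz00, Tz01, Tz10, Tz11] at *
      exfalso; linarith
    | cons w' ws' =>
      have h2 := lab_neg ws' (fun x hx => h' x (by simp [hx]))
      simp only [lab, m00, m01, m10, m11, S00, S01, S10, S11, Tz00, Tz01, Tz10, Tz11] at h0 h1
      have e1 : eC (lab ws) = eC (lab ws') := by linarith
      rw [e1] at h1 h3
      have e2 : w = w' := by
        have key : (w - w') * eC (lab ws') = eA (lab ws') - eA (lab ws) := by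
          linarith
        generalize eC (lab ws') = R at *
        generalize eA (lab ws') = A at *
        generalize eA (lab ws) = B at *
        rcases lt_trichotomy (w - w') 0 with hh | hh | hh
        · nlinarith
        · linarith
        · nlinarith
      subst e2
      have e3 : eA (lab ws) = eA (lab ws') := by linarith
      rw [ih ws' (fun x hx => h x (by simp [hx])) (fun x hx => h' x (by simp [hx])) e3 e1]

lemma key_inj (k k' : ℕ) (ws ws' : List ℤ) (h : ∀ x ∈ ws, x ≤ -2) (h' : ∀ x ∈ ws', x ≤ -2)
    (i j : ℤ) (e : (S * S) ^ k * lab ws = T ^ i * ((S * S) ^ k' * lab ws') * T ^ j) :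
    k = k' ∧ ws = ws' := by
  obtain ⟨a1, a2, a3, a4, a5⟩ := SSpow k
  obtain ⟨b1, b2, b3, b4, b5⟩ := SSpow k'
  have n1 := lab_neg ws h
  have n2 := lab_neg ws' h'
  have e00 := congrArg (eA) e
  have e01 := congrArg (eB) e
  have e10 := congrArg (eC) e
  have e11 := congrArg (eD) e
  have ed := congrArg (eE) e
  simp only [m00, m01, m10, m11, md, Tz00, Tz01, Tz10, Tz11, Tzd, a1, a2, a3, a4, a5,
    b1, b2, b3, b4, b5] at e00 e01 e10 e11 ed
  have sgn : ((-1 : ℤ)) ^ k = (-1) ^ k' := by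
    rcases neg_one_pow_eq_or ℤ k with u | u <;> rcases neg_one_pow_eq_or ℤ k' with v | v <;>
      rw [u, v] at e10 <;> rw [u, v] <;> exfalso <;> linarith
  rw [sgn] at e00 e01 e10 e11
  have hc : ∀ a b : ℤ, (-1) ^ k' * a = (-1) ^ k' * b → a = b := by
    intro a b hab
    rcases neg_one_pow_eq_or ℤ k' with u | u <;> rw [u] at hab <;> linarith
  have r : eC (lab ws) = eC (lab ws') := hc _ _ (by linarith)
  have p : eA (lab ws) = eA (lab ws') + i * eC (lab ws') :=
    hc _ _ (by linarith)
  have i0 : i = 0 := by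
    rw [r] at n1
    rw [p] at n1
    generalize eC (lab ws') = R at *
    generalize eA (lab ws') = A at *
    rcases lt_trichotomy i 0 with hh | hh | hh
    · nlinarith
    · assumption
    · nlinarith
  subst i0
  have ews := lab_col_inj ws ws' h h' (by linarith) r
  subst ews
  have q : eD (lab ws) = eC (lab ws) * j + eD (lab ws) := hc _ _ (by linarith)
  have j0 : j = 0 := by
    have : eC (lab ws) * j = 0 := by linarith
    rcases mul_eq_zero.1 this with u | u
    · exfalso; linarith
    · exact u
  subst j0
  refine ⟨?_, rfl⟩
  have : (k : ℤ) = k' := by linarith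
  exact_mod_cast this

lemma odd_ne (k k' : ℕ) (ws' : List ℤ) (h' : ∀ x ∈ ws', x ≤ -2)
    (i j : ℤ) (e : (S * S) ^ k = T ^ i * ((S * S) ^ k' * lab ws') * T ^ j) : False := by
  obtain ⟨a1, a2, a3, a4, a5⟩ := SSpow k
  obtain ⟨b1, b2, b3, b4, b5⟩ := SSpow k'
  have n2 := lab_neg ws' h'
  have e10 := congrArg (eC) e
  simp only [m00, m01, m10, m11, md, Tz00, Tz01, Tz10, Tz11, Tzd, a1, a2, a3, a4, a5,
    b1, b2, b3, b4, b5] at e10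
  rcases neg_one_pow_eq_or ℤ k' with u | u <;> rw [u] at e10 <;> linarith

lemma odd_inj (k k' : ℕ) 
    (i j : ℤ) (e : (S * S) ^ k = T ^ i * ((S * S) ^ k') * T ^ j) : k = k' := by
  obtain ⟨a1, a2, a3, a4, a5⟩ := SSpow k
  obtain ⟨b1, b2, b3, b4, b5⟩ := SSpow k'
  have e01 := congrArg (eB) e
  have ed := congrArg (eE) e
  simp only [m00, m01, m10, m11, md, Tz00, Tz01, Tz10, Tz11, Tzd, a1, a2, a3, a4, a5,
    b1, b2, b3, b4, b5] at e01 ed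
  have : i + j = 0 := by
    rcases neg_one_pow_eq_or ℤ k' with u | u <;> rw [u] at e01 <;> linarith
  have : (k : ℤ) = k' := by linarith
  exact_mod_cast this

lemma lab_odd (k : ℕ) : lab (List.replicate (2 * k + 1) 0) = (S * S) ^ (k + 1) := by
  have := lab_zeros_left k [0]
  rw [List.replicate_succ']
  rw [this]
  simp [lab, pow_succ]

/-- weight list standard in one of the two orientations -/
def Std2 (m : List ℤ) : Prop := WGraph.StdSeq m ∨ WGraph.StdSeq m.reverse

lemma std2_cases {m : List ℤ} (h : Std2 m) :
    (∃ k, m = List.replicate (2 * k + 1) 0) ∨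
    ∃ k ws, (∀ x ∈ ws, x ≤ -2) ∧ (m = List.replicate (2 * k) 0 ++ ws ∨
      m = ws ++ List.replicate (2 * k) 0) := by
  have hz : (∀ x ∈ m, x = 0) → (∃ k, m = List.replicate (2 * k + 1) 0) ∨
    ∃ k ws, (∀ x ∈ ws, x ≤ -2) ∧ (m = List.replicate (2 * k) 0 ++ ws ∨
      m = ws ++ List.replicate (2 * k) 0) := by
    intro hm
    have hm' := List.eq_replicate_of_mem hm
    rcases Nat.even_or_odd' m.length with ⟨k, hk | hk⟩
    · right; exact ⟨k, [], by simp, Or.inl (by rw [hk] at hm'; simpa using hm')⟩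
    · left; exact ⟨k, by rw [hk] at hm'; exact hm'⟩
  rcases h with (h | ⟨k, ws, e, hw⟩) | (h | ⟨k, ws, e, hw⟩)
  · exact hz h
  · right; exact ⟨k, ws, hw, Or.inl e⟩
  · exact hz (by simpa using h)
  · right
    refine ⟨k, ws.reverse, by simpa using hw, Or.inr ?_⟩
    rw [← List.reverse_reverse m, e]; simp

theorem lab_main {m m' : List ℤ} (h : Std2 m) (h' : Std2 m') (i j : ℤ)
    (e : lab m = T ^ i * lab m' * T ^ j) :
    m.length = m'.length ∧ ∀ (k : ℕ) (ws : List ℤ), (∀ x ∈ ws, x ≤ -2) →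
      (m = List.replicate (2 * k) 0 ++ ws ∨ m.reverse = List.replicate (2 * k) 0 ++ ws) →
      ((m' = List.replicate (2 * k) 0 ++ ws ∨ m' = List.replicate (2 * k) 0 ++ ws.reverse) ∨
      (m'.reverse = List.replicate (2 * k) 0 ++ ws ∨
        m'.reverse = List.replicate (2 * k) 0 ++ ws.reverse)) := by
  have e' : lab m' = T ^ (-i) * lab m * T ^ (-j) := by rw [e]; simp [mul_assoc]
  have hlab : ∀ (m : List ℤ) (k : ℕ) (ws : List ℤ), (m = List.replicate (2 * k) 0 ++ ws ∨
      m = ws ++ List.replicate (2 * k) 0) → lab m = (S * S) ^ k * lab ws := by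
    rintro m k ws (rfl | rfl)
    · exact lab_zeros_left _ _
    · exact lab_zeros_right _ _
  have len : ∀ (m : List ℤ) (k : ℕ) (ws : List ℤ), (m = List.replicate (2 * k) 0 ++ ws ∨
      m = ws ++ List.replicate (2 * k) 0) → m.length = 2 * k + ws.length := by
    rintro m k ws (rfl | rfl) <;> simp [add_comm]
  constructor
  · rcases std2_cases h with ⟨k, hk⟩ | ⟨k, ws, hw, hm⟩ <;>
      rcases std2_cases h' with ⟨k', hk'⟩ | ⟨k', ws', hw', hm'⟩
    · rw [hk, hk', lab_odd, lab_odd] at e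
      have := odd_inj _ _ _ _ e
      rw [hk, hk']; simp; omega
    · rw [hk, lab_odd, hlab _ _ _ hm'] at e
      exact (odd_ne _ _ _ hw' _ _ e).elim
    · rw [hk', lab_odd, hlab _ _ _ hm] at e'
      exact (odd_ne _ _ _ hw _ _ e').elim
    · rw [hlab _ _ _ hm, hlab _ _ _ hm'] at e
      obtain ⟨rfl, rfl⟩ := key_inj _ _ _ _ hw hw' _ _ e
      rw [len _ _ _ hm, len _ _ _ hm']
  · intro k ws hw hm
    have main : ∀ ws : List ℤ, (∀ x ∈ ws, x ≤ -2) → (m = List.replicate (2 * k) 0 ++ ws ∨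
      m = ws ++ List.replicate (2 * k) 0) → (m' = List.replicate (2 * k) 0 ++ ws ∨
      m' = ws ++ List.replicate (2 * k) 0) := by
      intro ws hw hm
      rcases std2_cases h' with ⟨k', hk'⟩ | ⟨k', ws', hw', hm'⟩
      · rw [hk', lab_odd, hlab _ _ _ hm] at e'
        exact (odd_ne _ _ _ hw _ _ e').elim
      · rw [hlab _ _ _ hm, hlab _ _ _ hm'] at e
        obtain ⟨rfl, rfl⟩ := key_inj _ _ _ _ hw hw' _ _ e
        exact hm'
    rcases hm with hm | hm
    · rcases main ws hw (Or.inl hm) with g | g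
      · exact Or.inl (Or.inl g)
      · right; right; rw [g]; simp
    · have hm2 : m = ws.reverse ++ List.replicate (2 * k) 0 := by
        rw [← List.reverse_reverse m, hm]; simp
      rcases main ws.reverse (by simpa using hw) (Or.inr hm2) with g | g
      · left; right; exact g
      · right; left; rw [g]; simp

end WG


set_option linter.all false

namespace WG
open WGraph

def Wsum (G : WGraph) (v : ℕ) (o1 o2 : Option ℕ) (m : ℕ → ℤ) : ℤ :=
  G.wt v + ∑ z ∈ G.verts.filter (fun z => G.adj v z = true ∧ some z ≠ o1 ∧ some z ≠ o2), m z

inductive Wk (G : WGraph) (X : ℕ → ℕ → Prop) :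
    ℕ → Option ℕ → HH → Option (ℕ × ℕ) → Prop
  | tail (v : ℕ) (j : ℤ) : Wk G X v none (S * T ^ j) none
  | node (u v : ℕ) : G.adj u v = true → X v u → Wk G X u (some v) S (some (v, u))
  | step (u v : ℕ) (y : Option ℕ) (m : ℕ → ℤ) (g g' : HH) (t : Option (ℕ × ℕ)) :
      G.adj u v = true → y ≠ some u →
      (∀ z, G.adj v z = true → z ≠ u → some z ≠ y →
        Wk G X v (some z) (T ^ (m z) * S) none) →
      Wk G X v y g t → g' = S * T ^ (Wsum G v (some u) y m) * g → Wk G X u (some v) g' t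

lemma Wk.adj {G X u o g t} (h : Wk G X u o g t) : ∀ v, o = some v → G.adj u v = true := by
  cases h with
  | tail => simp
  | node h1 h2 => rintro v ⟨⟩; assumption
  | step => rintro v ⟨⟩; assumption

lemma Wk.term {G X u o g t} (h : Wk G X u o g t) : ∀ x, t = some x → X x.1 x.2 := by
  induction h with
  | tail => simp
  | node h1 h2 => rintro v ⟨⟩; assumption
  | step u v y m g g' t a b c d e ih1 ih2 => exact ih2

lemma Wk.right {G X u o g t} (h : Wk G X u o g t) (ht : t = none) (j : ℤ) :
    Wk G X u o (g * T ^ j) t := by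
  induction h with
  | tail v i => rw [mul_assoc, ← zpow_add]; exact Wk.tail _ _
  | node h1 h2 => cases ht
  | step u v y m g g' t a b c d e ih1 ih2 =>
    refine Wk.step u v y m (g * T ^ j) _ t a b c (ih2 ht) ?_
    rw [e]; simp [mul_assoc]

lemma Wk.tail_inv {G X u g t} (h : Wk G X u none g t) : t = none ∧ ∃ j : ℤ, g = S * T ^ j := by
  cases h with
  | tail v j => exact ⟨rfl, j, rfl⟩

def so (s : ℕ → ℤ) : Option ℕ → ℤ
  | none => 0
  | some z => s z

lemma sum_so (A : Finset ℕ) (s : ℕ → ℤ) (o : Option ℕ) (h : ∀ z, o = some z → z ∈ A) :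
    ∑ z ∈ A.filter (fun z => some z ≠ o), s z = ∑ z ∈ A, s z - so s o := by
  cases o with
  | none => simp [so]
  | some y =>
    have : A.filter (fun z => some z ≠ some y) = A.erase y := by
      ext z; simp [and_comm]
    rw [this, ← Finset.add_sum_erase A s (h y rfl)]
    simp [so]

structure LS (G G' : WGraph) (v v' : ℕ) (σ : ℕ → Option ℕ) (s : ℕ → ℤ) (ex : Finset ℕ) :
    Prop where
  nb : ∀ z', G'.adj v' z' = true ↔ (∃ z, G.adj v z = true ∧ σ z = some z') ∨ z' ∈ ex
  inj : ∀ z1 z2 y, G.adj v z1 = true → G.adj v z2 = true → σ z1 = some y → σ z2 = some y →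
    z1 = z2
  disj : ∀ z y, G.adj v z = true → σ z = some y → y ∉ ex
  wt : G'.wt v' = G.wt v - ∑ z ∈ G.verts.filter (fun z => G.adj v z = true), s z - ex.card

lemma cfg {G G' : WGraph} {v v' : ℕ} {σ : ℕ → Option ℕ} {s : ℕ → ℤ} {ex : Finset ℕ}
    (h : LS G G' v v' σ s ex) (o1 o2 : Option ℕ)
    (a1 : ∀ z, o1 = some z → G.adj v z = true) (a2 : ∀ z, o2 = some z → G.adj v z = true)
    (d : ∀ z, o1 = some z → o2 ≠ some z) (m : ℕ → ℤ) (P' : ℕ → ℤ → Prop)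
    (hP : ∀ z, G.adj v z = true → some z ≠ o1 → some z ≠ o2 →
      (∀ z', σ z = some z' → P' z' (m z + s z)) ∧ (σ z = none → m z + s z = 0))
    (hex : ∀ z ∈ ex, P' z 1) :
    ∃ m' : ℕ → ℤ, (∀ z', G'.adj v' z' = true → some z' ≠ o1.bind σ → some z' ≠ o2.bind σ →
      P' z' (m' z')) ∧
      Wsum G' v' (o1.bind σ) (o2.bind σ) m' = Wsum G v o1 o2 m - so s o1 - so s o2 := by
  classical
  set N := G.verts.filter (fun z => G.adj v z = true) with hN
  have memN : ∀ z, z ∈ N ↔ G.adj v z = true := by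
    intro z; simp only [hN, Finset.mem_filter]
    exact ⟨fun h => h.2, fun h => ⟨(G.support _ _ h).2, h⟩⟩
  let m' : ℕ → ℤ := fun z' => if z' ∈ ex then 1 else
    ∑ z ∈ N.filter (fun z => σ z = some z'), (m z + s z)
  have hm' : ∀ z z', G.adj v z = true → σ z = some z' → m' z' = m z + s z := by
    intro z z' hz e
    have : N.filter (fun z => σ z = some z') = {z} := by
      ext y
      simp only [Finset.mem_filter, memN, Finset.mem_singleton]
      exact ⟨fun ⟨u1, u2⟩ => h.inj _ _ _ u1 hz u2 e, by rintro rfl; exact ⟨hz, e⟩⟩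
    simp [m', h.disj z z' hz e, this]
  have hex' : ∀ z ∈ ex, m' z = 1 := by intro z hz; simp [m', hz]
  have bn : ∀ (o : Option ℕ), (∀ z, o = some z → G.adj v z = true) → ∀ z z',
      G.adj v z = true → σ z = some z' → (some z' ≠ o.bind σ ↔ some z ≠ o) := by
    intro o ho z z' hz e
    cases o with
    | none => simp
    | some y =>
      have hy := ho y rfl
      simp only [Option.bind_some, ne_eq, Option.some.injEq, not_iff_not]
      constructor
      · intro e2; exact h.inj _ _ _ hz hy e e2.symm
      · rintro rfl; exact e.symm
  have be : ∀ (o : Option ℕ), (∀ z, o = some z → G.adj v z = true) → ∀ z' ∈ ex,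
      some z' ≠ o.bind σ := by
    intro o ho z' hz
    cases o with
    | none => simp
    | some y => intro e; exact h.disj y z' (ho y rfl) e.symm hz
  refine ⟨m', ?_, ?_⟩
  · intro z' hz' n1 n2
    rcases (h.nb z').1 hz' with ⟨z, hz, e⟩ | hz
    · rw [hm' z z' hz e]
      exact (hP z hz ((bn o1 a1 z z' hz e).1 n1) ((bn o2 a2 z z' hz e).1 n2)).1 z' e
    · rw [hex' z' hz]; exact hex z' hz
  · set F := G.verts.filter (fun z => G.adj v z = true ∧ some z ≠ o1 ∧ some z ≠ o2) with hF
    set F' := G'.verts.filter (fun z => G'.adj v' z = true ∧ some z ≠ o1.bind σ ∧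
      some z ≠ o2.bind σ) with hF'
    have memF : ∀ z, z ∈ F ↔ G.adj v z = true ∧ some z ≠ o1 ∧ some z ≠ o2 := by
      intro z; simp only [hF, Finset.mem_filter]
      exact ⟨fun h => h.2, fun h => ⟨(G.support _ _ h.1).2, h⟩⟩
    have memF' : ∀ z, z ∈ F' ↔ G'.adj v' z = true ∧ some z ≠ o1.bind σ ∧
        some z ≠ o2.bind σ := by
      intro z; simp only [hF', Finset.mem_filter]
      exact ⟨fun h => h.2, fun h => ⟨(G'.support _ _ h.1).2, h⟩⟩
    have exF : ex ⊆ F' := by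
      intro z hz
      rw [memF']
      exact ⟨(h.nb z).2 (Or.inr hz), be o1 a1 z hz, be o2 a2 z hz⟩
    have e1 : ∑ z ∈ F', m' z = ∑ z ∈ F' \ ex, m' z + ex.card := by
      rw [← Finset.sum_sdiff exF]
      congr 1
      rw [Finset.sum_congr rfl hex']; simp
    have e2 : ∑ z ∈ F' \ ex, m' z = ∑ z ∈ F.filter (fun z => (σ z).isSome), (m z + s z) := by
      symm
      refine Finset.sum_bij (fun z hz => (σ z).get (Finset.mem_filter.1 hz).2) ?_ ?_ ?_ ?_
      · intro z hz
        have hz2 := Finset.mem_filter.1 hz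
        obtain ⟨b1, b2, b3⟩ := (memF z).1 hz2.1
        have e : σ z = some ((σ z).get hz2.2) := by simp
        rw [Finset.mem_sdiff, memF']
        exact ⟨⟨(h.nb _).2 (Or.inl ⟨z, b1, e⟩), (bn o1 a1 _ _ b1 e).2 b2,
          (bn o2 a2 _ _ b1 e).2 b3⟩, h.disj _ _ b1 e⟩
      · intro z hz y hy e
        have hz2 := Finset.mem_filter.1 hz
        have hy2 := Finset.mem_filter.1 hy
        refine h.inj z y ((σ z).get hz2.2) ((memF z).1 hz2.1).1 ((memF y).1 hy2.1).1
          (by simp) ?_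
        rw [e]; simp
      · intro z' hz'
        obtain ⟨c1, c2⟩ := Finset.mem_sdiff.1 hz'
        obtain ⟨c3, c4, c5⟩ := (memF' z').1 c1
        rcases (h.nb z').1 c3 with ⟨z, hz, e⟩ | hz
        · refine ⟨z, Finset.mem_filter.2 ⟨(memF z).2 ⟨hz, (bn o1 a1 _ _ hz e).1 c4,
            (bn o2 a2 _ _ hz e).1 c5⟩, by simp [e]⟩, by simp [e]⟩
        · exact (c2 hz).elim
      · intro z hz
        have hz2 := Finset.mem_filter.1 hz
        exact (hm' _ _ ((memF z).1 hz2.1).1 (by simp)).symm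
    have e3 : ∑ z ∈ F.filter (fun z => (σ z).isSome), (m z + s z) = ∑ z ∈ F, (m z + s z) := by
      apply Finset.sum_filter_of_ne
      intro z hz hne
      obtain ⟨b1, b2, b3⟩ := (memF z).1 hz
      by_contra hc
      exact hne ((hP z b1 b2 b3).2 (by simpa using hc))
    have e4 : ∑ z ∈ F, s z = ∑ z ∈ N, s z - so s o1 - so s o2 := by
      have : F = (N.filter (fun z => some z ≠ o1)).filter (fun z => some z ≠ o2) := by
        ext z; simp [memF, memN, and_assoc]
      rw [this, sum_so, sum_so]
      · intro z hz; exact (memN z).2 (a1 z hz)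
      · intro z hz
        rw [Finset.mem_filter]
        exact ⟨(memN z).2 (a2 z hz), fun e => d z e.symm hz⟩
    unfold Wsum
    rw [← hF, ← hF', e1, e2, e3, Finset.sum_add_distrib, e4, h.wt]
    ring

def tm (f : ℕ → ℕ) (σ : ℕ → ℕ → Option ℕ) (t : Option (ℕ × ℕ)) : Option (ℕ × ℕ) :=
  t.map (fun x => (f x.1, (σ x.1 x.2).getD 0))

section
variable (G G' : WGraph) (f : ℕ → ℕ) (σ : ℕ → ℕ → Option ℕ)
  (s : ℕ → ℕ → ℤ) (X' : ℕ → ℕ → Prop)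

def AC (p q : ℕ) (g : HH) (t : Option (ℕ × ℕ)) : Prop :=
  ∀ p', σ q p = some p' →
    ∃ j : ℤ, Wk G' X' p' (some (f q)) (S * T ^ (-s q p) * S⁻¹ * g * T ^ j) (tm f σ t)

def BC (p : ℕ) (o : Option ℕ) (g : HH) (t : Option (ℕ × ℕ)) : Prop :=
  ∃ j : ℤ, Wk G' X' (f p) (o.bind (σ p)) (T ^ (so (s p) o) * g * T ^ j) (tm f σ t)

/-- X-free part of a simulation -/
structure Sim (P : ℕ → Prop) (ex : ℕ → Finset ℕ) : Prop where
  ls : ∀ v, P v → LS G G' v (f v) (σ v) (s v) (ex v)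
  exT : ∀ X' : ℕ → ℕ → Prop, ∀ v, P v → ∀ z ∈ ex v,
    Wk G' X' (f v) (some z) (T ^ (1 : ℤ) * S) none
  back : ∀ p q, P p → P q → G.adj p q = true → ∃ p', σ q p = some p'
  E1 : ∀ X' : ℕ → ℕ → Prop, ∀ p q, P p → P q → G.adj p q = true → ∀ p', σ q p = some p' →
    ∀ g t, Wk G' X' p' (some (f q)) (S * T ^ (-s q p) * S⁻¹ * g) t →
      Wk G' X' (f p) (σ p q) (T ^ (s p q) * g) t
  E2 : ∀ X' : ℕ → ℕ → Prop, ∀ p q, P p → ¬ P q → G.adj p q = true → ∀ y m g t, y ≠ some p →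
    (∀ z, G.adj q z = true → z ≠ p → some z ≠ y → P z →
      AC G' f σ s X' q z (T ^ (m z) * S) none) →
    (∀ z, y = some z → G.adj q z = true ∧ (P z → AC G' f σ s X' q z g t)) →
    (y = none → t = none ∧ ∃ j : ℤ, g = S * T ^ j) →
    BC G' f σ s X' p (some q) (S * T ^ (Wsum G q (some p) y m) * g) t
end

theorem Sim.main {G G' : WGraph} {f σ s P ex} (h : Sim G G' f σ s P ex)
    {X X' : ℕ → ℕ → Prop} (hX : ∀ q p, X q p → P q ∧ ∀ p', σ q p = some p' → X' (f q) p')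
    {p o g t} (hw : Wk G X p o g t) :
    (P p → BC G' f σ s X' p o g t) ∧ (∀ q, o = some q → P q → AC G' f σ s X' p q g t) := by
  have AB : ∀ p q g t, P p → P q → G.adj p q = true → AC G' f σ s X' p q g t →
      BC G' f σ s X' p (some q) g t := by
    intro p q g t hp hq ha hA
    obtain ⟨p', hp'⟩ := h.back p q hp hq ha
    obtain ⟨j, hj⟩ := hA p' hp'
    refine ⟨j, ?_⟩
    have := h.E1 X' p q hp hq ha p' hp' (g * T ^ j) _ (by simpa [mul_assoc] using hj)
    simpa [so, mul_assoc] using this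
  induction hw with
  | tail v j =>
    refine ⟨fun hp => ⟨0, ?_⟩, by simp⟩
    simpa [so, tm] using Wk.tail (G := G') (X := X') (f v) j
  | node u v ha hx =>
    obtain ⟨hv, hx'⟩ := hX _ _ hx
    have hA : AC G' f σ s X' u v S (some (v, u)) := by
      intro p' hp'
      refine ⟨s v u, ?_⟩
      have : S * T ^ (-s v u) * S⁻¹ * S * T ^ (s v u) = S := by simp
      rw [this]
      have e : tm f σ (some (v, u)) = some (f v, p') := by simp [tm, hp']
      rw [e]
      refine Wk.node _ _ (G'.symm _ _ ?_) (hx' p' hp')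
      exact ((h.ls v hv).nb p').2 (Or.inl ⟨u, G.symm _ _ ha, hp'⟩)
    exact ⟨fun hp => AB _ _ _ _ hp hv ha hA, by rintro q ⟨⟩ _; exact hA⟩
  | step u v y m g g' t ha hy hz hyw e ih1 ih2 =>
    have hA : P v → AC G' f σ s X' u v g' t := by
      intro hv p' hp'
      have hls := h.ls v hv
      have hay : ∀ z, y = some z → G.adj v z = true := fun z => hyw.adj z
      obtain ⟨m', hm1, hm2⟩ := cfg hls (some u) y
        (by rintro z ⟨⟩; exact G.symm _ _ ha) hay
        (by rintro z ⟨⟩; exact hy) m (fun z k => Wk G' X' (f v) (some z) (T ^ k * S) none)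
        (by
          intro z hz1 hz2 hz3
          obtain ⟨j, hj⟩ := (ih1 z hz1 (fun e => hz2 (by rw [e])) hz3).1 hv
          constructor
          · intro z' hz'
            simp only [Option.bind_some, hz', so] at hj
            have := hj.right rfl (-j)
            have e : T ^ (m z + s v z) * S = T ^ s v z * (T ^ m z * S) * T ^ j * T ^ (-j) := by
              rw [add_comm, zpow_add]; simp [mul_assoc]
            rw [e]; exact this
          · intro hz'
            simp only [Option.bind_some, hz', so] at hj
            obtain ⟨_, j', hj'⟩ := hj.tail_inv
            rw [add_comm]
            apply TS_inj (i := j) (j := j')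
            rw [← hj', zpow_add]; simp [mul_assoc])
        (h.exT X' v hv)
      obtain ⟨j, hj⟩ := ih2.1 hv
      refine ⟨j, ?_⟩
      refine Wk.step _ _ (y.bind (σ v)) m' _ _ _ ?_ ?_ ?_ hj ?_
      · exact G'.symm _ _ ((hls.nb p').2 (Or.inl ⟨u, G.symm _ _ ha, hp'⟩))
      · cases y with
        | none => simp
        | some z =>
          intro e
          exact hy (by rw [hls.inj z u p' (hay z rfl) (G.symm _ _ ha) e hp'])
      · intro z hz1 hz2 hz3
        refine hm1 z hz1 ?_ hz3
        simp only [Option.bind_some, hp']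
        simpa using hz2
      · simp only [Option.bind_some, hp'] at hm2
        rw [hm2, e]
        rw [show so (s v) (some u) = s v u from rfl]
        rw [show Wsum G v (some u) y m - s v u - so (s v) y =
          -s v u + Wsum G v (some u) y m + - so (s v) y by ring, zpow_add, zpow_add]
        simp [mul_assoc]
    refine ⟨fun hp => ?_, by rintro q ⟨⟩; exact hA⟩
    by_cases hv : P v
    · exact AB _ _ _ _ hp hv ha (hA hv)
    · rw [e]
      refine h.E2 X' u v hp hv ha y m g t hy ?_ ?_ ?_
      · intro z h1 h2 h3 h4
        exact (ih1 z h1 h2 h3).2 z rfl h4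
      · rintro z rfl
        exact ⟨hyw.adj z rfl, ih2.2 z rfl⟩
      · rintro rfl
        exact hyw.tail_inv

end WG


set_option linter.all false

namespace WG
open WGraph

lemma relz : T ^ (1:ℤ) * S * T ^ (1:ℤ) = S * T ^ (-1:ℤ) * S := by
  simpa using rel

lemma rel2 : T ^ (-1:ℤ) * S * T ^ (-1:ℤ) = S * T ^ (1:ℤ) * S⁻¹ := by
  have h := relz
  have h2 : ∀ g, S * (S * g) = g * (S * S) := by
    intro g; rw [← mul_assoc]; exact SS_comm g
  have h3 : S * T ^ (-1:ℤ) = T ^ (1:ℤ) * S * T ^ (1:ℤ) * S⁻¹ := by rw [h]; simp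
  rw [mul_assoc, h3]
  simp [mul_assoc]

lemma relA (g : HH) : S * T ^ (-1:ℤ) * (S * T ^ (-1:ℤ) * S⁻¹ * g) = T ^ (1:ℤ) * g := by
  have : S * T ^ (-1:ℤ) * (S * T ^ (-1:ℤ) * S⁻¹ * g) = (S * T ^ (-1:ℤ) * S) * T ^ (-1:ℤ) * S⁻¹ * g := by
    simp [mul_assoc]
  rw [this, ← relz]; simp [mul_assoc]

def bot : ℕ → ℕ → Prop := fun _ _ => False

def Triv (G : WGraph) (v z : ℕ) : Prop := ∃ m : ℤ, Wk G bot v (some z) (T ^ m * S) none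

def XX (G : WGraph) (v u : ℕ) : Prop := G.adj v u = true ∧ ¬ Triv G v u ∧
  ∃ z1 z2 z3, z1 ≠ z2 ∧ z1 ≠ z3 ∧ z2 ≠ z3 ∧ (G.adj v z1 = true ∧ ¬ Triv G v z1) ∧
    (G.adj v z2 = true ∧ ¬ Triv G v z2) ∧ (G.adj v z3 = true ∧ ¬ Triv G v z3)

def Two (G : WGraph) (v : ℕ) : Prop := ∃ c d, ∀ z, G.adj v z = true → z = c ∨ z = d

structure Half (G G' : WGraph) (f σ s) (P : ℕ → Prop) (ex) (f' : ℕ → ℕ) (σ' : ℕ → ℕ → Option ℕ)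
    (P' : ℕ → Prop) : Prop where
  sim : Sim G G' f σ s P ex
  pv : ∀ v, P v → v ∈ G.verts
  inv1 : ∀ v, P v → P' (f v) ∧ f' (f v) = v
  inv2 : ∀ v z z', P v → G.adj v z = true → σ v z = some z' → σ' (f v) z' = some z
  triv : ∀ v z, P v → G.adj v z = true → σ v z = none → Triv G v z
  out : ∀ v, v ∈ G.verts → ¬ P v → Two G v ∧ ∃ u, G.adj v u = true ∧ P u

def Pair (G G' : WGraph) : Prop := ∃ f σ s P ex f' σ' s' P' ex',
  Half G G' f σ s P ex f' σ' P' ∧ Half G' G f' σ' s' P' ex' f σ P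

lemma Pair.symm {G G'} (h : Pair G G') : Pair G' G := by
  obtain ⟨f, σ, s, P, ex, f', σ', s', P', ex', h1, h2⟩ := h
  exact ⟨f', σ', s', P', ex', f, σ, s, P, ex, h2, h1⟩

lemma Sim.triv {G G' f σ s P ex} (h : Sim G G' f σ s P ex) {v z z'} (hv : P v)
    (e : σ v z = some z') (ht : Triv G v z) : Triv G' (f v) z' := by
  obtain ⟨m, hm⟩ := ht
  obtain ⟨j, hj⟩ := (h.main (X' := bot) (fun q p h => h.elim) hm).1 hv
  refine ⟨s v z + m, ?_⟩
  have := hj.right rfl (-j)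
  simp only [Option.bind_some, e, so] at this
  rw [zpow_add]
  simpa [mul_assoc, tm] using this

lemma Half.ntriv {G G' f σ s P ex f' σ' s' P' ex'} (h : Half G G' f σ s P ex f' σ' P')
    (h' : Half G' G f' σ' s' P' ex' f σ P) {v z} (hv : P v) (ha : G.adj v z = true)
    (hn : ¬ Triv G v z) : ∃ z', σ v z = some z' ∧ G'.adj (f v) z' = true ∧ ¬ Triv G' (f v) z' := by
  rcases e : σ v z with _ | z'
  · exact (hn (h.triv v z hv ha e)).elim
  · refine ⟨z', rfl, ((h.sim.ls v hv).nb z').2 (Or.inl ⟨z, ha, e⟩), fun ht => hn ?_⟩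
    have := h'.sim.triv (h.inv1 v hv).1 (h.inv2 v z z' hv ha e) ht
    rwa [(h.inv1 v hv).2] at this

lemma Half.X {G G' f σ s P ex f' σ' s' P' ex'} (h : Half G G' f σ s P ex f' σ' P')
    (h' : Half G' G f' σ' s' P' ex' f σ P) {v u} (hx : XX G v u) :
    P v ∧ ∃ u', σ v u = some u' ∧ XX G' (f v) u' := by
  obtain ⟨ha, hn, z1, z2, z3, n12, n13, n23, ⟨a1, t1⟩, ⟨a2, t2⟩, ⟨a3, t3⟩⟩ := hx
  have hv : P v := by
    by_contra hv
    obtain ⟨⟨c, d, hcd⟩, _⟩ := h.out v (G.support _ _ ha).1 hv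
    have := hcd _ a1; have := hcd _ a2; have := hcd _ a3
    grind
  refine ⟨hv, ?_⟩
  obtain ⟨u', e, b1, b2⟩ := h.ntriv h' hv ha hn
  obtain ⟨y1, e1, b11, b12⟩ := h.ntriv h' hv a1 t1
  obtain ⟨y2, e2, b21, b22⟩ := h.ntriv h' hv a2 t2
  obtain ⟨y3, e3, b31, b32⟩ := h.ntriv h' hv a3 t3
  have inj := (h.sim.ls v hv).inj
  refine ⟨u', e, b1, b2, y1, y2, y3, ?_, ?_, ?_, ⟨b11, b12⟩, ⟨b21, b22⟩, ⟨b31, b32⟩⟩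
  · rintro rfl; exact n12 (inj _ _ _ a1 a2 e1 e2)
  · rintro rfl; exact n13 (inj _ _ _ a1 a3 e1 e3)
  · rintro rfl; exact n23 (inj _ _ _ a2 a3 e2 e3)

structure Hom (G G' : WGraph) (β : ℕ → ℕ) (φ : ℕ × ℕ → ℕ × ℕ) : Prop where
  hX : ∀ x : ℕ × ℕ, XX G x.1 x.2 → XX G' (φ x).1 (φ x).2
  base : ∀ x : ℕ × ℕ, XX G x.1 x.2 → (φ x).1 = β x.1
  wk : ∀ x : ℕ × ℕ, XX G x.1 x.2 → ∀ g t, Wk G (XX G) x.1 (some x.2) g t →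
    ∃ i j : ℤ, Wk G' (XX G') (φ x).1 (some (φ x).2) (T ^ i * g * T ^ j) (t.map φ)

def Rel (G G' : WGraph) : Prop := ∃ β φ β' φ', Hom G G' β φ ∧ Hom G' G β' φ' ∧
  (∀ x : ℕ × ℕ, XX G x.1 x.2 → φ' (φ x) = x) ∧ (∀ x : ℕ × ℕ, XX G' x.1 x.2 → φ (φ' x) = x)

lemma Half.hom {G G' f σ s P ex f' σ' s' P' ex'} (h : Half G G' f σ s P ex f' σ' P')
    (h' : Half G' G f' σ' s' P' ex' f σ P) :
    Hom G G' f (fun x => (f x.1, (σ x.1 x.2).getD 0)) where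
  hX := by
    rintro ⟨v, u⟩ hx
    obtain ⟨hv, u', e, hx'⟩ := h.X h' hx
    simpa [e] using hx'
  base := by intros; rfl
  wk := by
    rintro ⟨v, u⟩ hx g t hw
    obtain ⟨hv, u', e, hx'⟩ := h.X h' hx
    obtain ⟨j, hj⟩ := (h.sim.main (X' := XX G') (fun q p hq => by
      obtain ⟨hv, u', e, hx'⟩ := h.X h' hq
      refine ⟨hv, fun p' hp' => ?_⟩
      rw [e] at hp'; cases hp'; exact hx') hw).1 hv
    refine ⟨s v u, j, ?_⟩
    simp only [Option.bind_some, e, so] at hj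
    simp only [e, Option.getD_some]
    exact hj

lemma Pair.rel {G G'} (h : Pair G G') : Rel G G' := by
  obtain ⟨f, σ, s, P, ex, f', σ', s', P', ex', h1, h2⟩ := h
  refine ⟨_, _, _, _, h1.hom h2, h2.hom h1, ?_, ?_⟩
  · rintro ⟨v, u⟩ hx
    obtain ⟨hv, u', e, hx'⟩ := h1.X h2 hx
    simp [e, (h1.inv1 v hv).2, h1.inv2 v u u' hv hx.1 e]
  · rintro ⟨v, u⟩ hx
    obtain ⟨hv, u', e, hx'⟩ := h2.X h1 hx
    simp [e, (h2.inv1 v hv).2, h2.inv2 v u u' hv hx.1 e]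

lemma Rel.symm {G G'} (h : Rel G G') : Rel G' G := by
  obtain ⟨a, b, c, d, h1, h2, h3, h4⟩ := h
  exact ⟨c, d, a, b, h2, h1, h4, h3⟩

lemma Hom.trans {G G' G'' β φ β' φ'} (h : Hom G G' β φ) (h' : Hom G' G'' β' φ') :
    Hom G G'' (β' ∘ β) (φ' ∘ φ) where
  hX := fun x hx => h'.hX _ (h.hX _ hx)
  base := fun x hx => by
    simp [h'.base _ (h.hX _ hx), h.base _ hx]
  wk := fun x hx g t hw => by
    obtain ⟨i, j, h1⟩ := h.wk x hx g t hw
    obtain ⟨i', j', h2⟩ := h'.wk _ (h.hX _ hx) _ _ h1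
    refine ⟨i' + i, j + j', ?_⟩
    rw [zpow_add, zpow_add]
    simpa [mul_assoc] using h2

lemma Rel.trans {G G' G''} (h : Rel G G') (h' : Rel G' G'') : Rel G G'' := by
  obtain ⟨a, b, c, d, h1, h2, h3, h4⟩ := h
  obtain ⟨a', b', c', d', h1', h2', h3', h4'⟩ := h'
  refine ⟨_, _, _, _, h1.trans h1', h2'.trans h2, ?_, ?_⟩
  · intro x hx; simp [h3' _ (h1.hX _ hx), h3 _ hx]
  · intro x hx; simp [h4 _ (h2'.hX _ hx), h4' _ hx]

lemma Rel.refl (G) : Rel G G := by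
  have : Hom G G id id := ⟨fun x h => h, fun _ _ => rfl, fun x hx g t h => ⟨0, 0, by simpa using h⟩⟩
  exact ⟨_, _, _, _, this, this, fun _ _ => rfl, fun _ _ => rfl⟩

end WG


set_option linter.all false

namespace WG
open WGraph

lemma iso_half {G G' : WGraph} {f f' : ℕ → ℕ}
    (hm : ∀ v ∈ G.verts, f v ∈ G'.verts) (hm' : ∀ v ∈ G'.verts, f' v ∈ G.verts)
    (hl : ∀ v ∈ G.verts, f' (f v) = v) (hr : ∀ v ∈ G'.verts, f (f' v) = v)
    (ha : ∀ u ∈ G.verts, ∀ v ∈ G.verts, G'.adj (f u) (f v) = G.adj u v)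
    (hw : ∀ v ∈ G.verts, G'.wt (f v) = G.wt v) :
    Half G G' f (fun _ z => some (f z)) (fun _ _ => 0) (· ∈ G.verts) (fun _ => ∅) f'
      (fun _ z => some (f' z)) (· ∈ G'.verts) where
  sim := {
    ls := fun v hv => {
      nb := by
        intro z'
        constructor
        · intro h
          have hz := (G'.support _ _ h).2
          refine Or.inl ⟨f' z', ?_, by simp [hr z' hz]⟩
          rw [← ha v hv _ (hm' z' hz), hr z' hz]; exact h
        · rintro (⟨z, hz, e⟩ | h)
          · cases e; rw [ha v hv z (G.support _ _ hz).2]; exact hz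
          · simp at h
      inj := by
        intro z1 z2 y a1 a2 e1 e2
        simp only [Option.some.injEq] at e1 e2
        rw [← hl z1 (G.support _ _ a1).2, e1, ← e2, hl z2 (G.support _ _ a2).2]
      disj := by simp
      wt := by simp [hw v hv] }
    exT := by simp
    back := by intro p q _ _ _; exact ⟨_, rfl⟩
    E1 := by
      rintro X' p q hp hq ha p' ⟨⟩ g t h
      simpa using h
    E2 := by
      intro X' p q hp hq ha
      exact (hq (G.support _ _ ha).2).elim }
  pv := fun v h => h
  inv1 := fun v hv => ⟨hm v hv, hl v hv⟩
  inv2 := by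
    rintro v z z' hv hz ⟨⟩
    simp [hl z (G.support _ _ hz).2]
  triv := by simp
  out := fun v h h' => (h' h).elim

lemma iso_pair {G G' : WGraph} (h : WIso G G') : Pair G G' := by
  obtain ⟨f, hb, ha, hw⟩ := h
  let f' := Function.invFunOn f (G.verts : Set ℕ)
  have hl : ∀ v ∈ G.verts, f' (f v) = v := fun v hv => hb.2.1.leftInvOn_invFunOn hv
  have hr : ∀ v ∈ G'.verts, f (f' v) = v := fun v hv => hb.2.2.rightInvOn_invFunOn hv
  have hm : ∀ v ∈ G.verts, f v ∈ G'.verts := fun v hv => hb.1 hv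
  have hm' : ∀ v ∈ G'.verts, f' v ∈ G.verts := fun v hv => by
    obtain ⟨u, hu, rfl⟩ := hb.2.2 hv
    rw [hl u hu]; exact hu
  refine ⟨_, _, _, _, _, _, _, _, _, _, iso_half hm hm' hl hr ha hw,
    iso_half hm' hm hr hl ?_ ?_⟩
  · intro u hu v hv
    rw [← ha _ (hm' u hu) _ (hm' v hv), hr u hu, hr v hv]
  · intro v hv
    rw [← hw _ (hm' v hv), hr v hv]

lemma nadj {G : WGraph} {x : ℕ} (hx : x ∉ G.verts) (v : ℕ) : ¬ G.adj v x = true ∧ ¬ G.adj x v = true :=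
  ⟨fun h => hx (G.support _ _ h).2, fun h => hx (G.support _ _ h).1⟩

lemma Wsum_leaf (G : WGraph) {x p : ℕ} (y : Option ℕ) (m : ℕ → ℤ)
    (h : ∀ z, G.adj x z = true → z = p ∨ some z = y) : Wsum G x (some p) y m = G.wt x := by
  unfold Wsum
  rw [Finset.filter_false_of_mem]
  · simp
  · rintro z hz ⟨h1, h2, h3⟩
    rcases h z h1 with rfl | h
    · exact h2 rfl
    · exact h3 h

lemma outer_pair {G G' : WGraph} {a x : ℕ} (h : IsOuterBlowup G G' a x) : Pair G G' := by
  obtain ⟨hav, hx, hV, hA, hW⟩ := h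
  have hn := fun v => nadj hx v
  have hxa : x ≠ a := by rintro rfl; exact hx hav
  have hA1 : ∀ z, G'.adj x z = true → z = a := by
    intro z hz
    rcases (hA x z).1 hz with h | h | h
    · exact ((hn z).2 h).elim
    · exact h.2
    · exact (hxa h.2).elim
  have wkx : ∀ X' : ℕ → ℕ → Prop, Wk G' X' a (some x) (T ^ (1:ℤ) * S) none := by
    intro X'
    refine Wk.step a x none 0 (S * T ^ (-1:ℤ)) _ none ((hA _ _).2 (by simp)) (by simp) ?_
      (Wk.tail _ _) ?_
    · intro z hz h1 h2; exact (h1 (hA1 z hz)).elim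
    · rw [Wsum_leaf G' none 0 (fun z hz => Or.inl (hA1 z hz)), hW]
      have := relz
      simp only [if_true]
      rw [← mul_assoc, ← this]; simp [mul_assoc]
  refine ⟨id, fun _ z => some z, fun _ _ => 0, (· ∈ G.verts), fun v => if v = a then {x} else ∅,
    id, fun _ z => if z = x then none else some z, fun _ z => if z = x then -1 else 0,
    (· ∈ G.verts), fun _ => ∅, ?_, ?_⟩
  · refine ⟨⟨?_, ?_, ?_, ?_, ?_⟩, fun v h => h, fun v h => ⟨h, rfl⟩, ?_, ?_, fun v h h' => (h' h).elim⟩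
    · intro v hv
      have hvx : v ≠ x := by rintro rfl; exact hx hv
      refine ⟨?_, ?_, ?_, ?_⟩
      · intro z'
        simp only [id, hA, Option.some.injEq, exists_eq_right, hvx, false_and, false_or]
        split_ifs with e <;> simp [e]
      · grind
      · intro z y hz e
        cases e
        have : z ≠ x := by rintro rfl; exact (hn v).1 hz
        split_ifs <;> simp [this]
      · simp only [id, hW, hvx, if_false]
        split_ifs <;> simp
    · intro X' v hv z hz
      split_ifs at hz with e
      · subst e
        rw [Finset.mem_singleton] at hz
        subst hz
        exact wkx X'
      · simp at hz
    · intro p q _ _ _; exact ⟨_, rfl⟩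
    · rintro X' p q hp hq ha p' ⟨⟩ g t h
      simpa using h
    · intro X' p q hp hq ha
      exact (hq (G.support _ _ ha).2).elim
    · rintro v z z' hv hz ⟨⟩
      have : z ≠ x := by rintro rfl; exact (hn v).1 hz
      simp [this]
    · simp
  · refine ⟨⟨?_, ?_, ?_, ?_, ?_⟩, fun v h => by simp [hV, h], fun v h => ⟨h, rfl⟩, ?_, ?_, ?_⟩
    · intro v hv
      have hvx : v ≠ x := by rintro rfl; exact hx hv
      refine ⟨?_, ?_, ?_, ?_⟩
      · intro z'
        constructor
        · intro h
          have hz' : z' ≠ x := by rintro rfl; exact (hn v).1 h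
          exact Or.inl ⟨z', (hA _ _).2 (Or.inl h), by simp [hz']⟩
        · rintro (⟨z, hz, e⟩ | h)
          · by_cases e' : z = x
            · simp [e'] at e
            simp only [e', if_false, Option.some.injEq] at e
            subst e
            rcases (hA v z).1 hz with h | h | h
            · exact h
            · exact (hvx h.1).elim
            · exact (e' h.1).elim
          · simp at h
      · grind
      · simp
      · simp only [id, hW, hvx, if_false, Finset.card_empty]
        rw [Finset.sum_ite_eq']
        have e1 : x ∈ G'.verts.filter (fun z => G'.adj v z = true) ↔ v = a := by
          rw [Finset.mem_filter, hV, hA]; simp [hn, hvx]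
        simp only [e1]; by_cases e : v = a <;> simp [e]
    · simp
    · intro p q hp hq _
      have : p ≠ x := by rintro rfl; exact hx hp
      exact ⟨p, by simp [this]⟩
    · rintro X' p q hp hq ha p' e g t h
      have hpx : p ≠ x := by rintro rfl; exact hx hp
      have hqx : q ≠ x := by rintro rfl; exact hx hq
      simp only [hpx, if_false, Option.some.injEq] at e
      subst e
      simpa [hpx, hqx] using h
    · intro X' p q hp hq ha y m g t hy h1 h2 h3
      have hqx : q = x := by
        have := (G'.support _ _ ha).2
        rw [hV] at this; simpa [hq] using this
      subst hqx
      have hpa := hA1 p (G'.symm _ _ ha)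
      subst hpa
      have hy : y = none := by
        rcases y with _ | z
        · rfl
        · exact (hy (by rw [hA1 z (h2 z rfl).1])).elim
      obtain ⟨rfl, j, rfl⟩ := h3 hy
      subst hy
      rw [Wsum_leaf G' none m (fun z hz => Or.inl (hA1 z hz)), hW]
      refine ⟨0, ?_⟩
      have e : T ^ (-1:ℤ) * (S * T ^ (-1:ℤ) * (S * T ^ j)) * T ^ (0:ℤ) = S * T ^ (1 + j) := by
        rw [show T ^ (-1:ℤ) * (S * T ^ (-1:ℤ) * (S * T ^ j)) * T ^ (0:ℤ) = T ^ (-1:ℤ) * (S * T ^ (-1:ℤ) * S) * T ^ j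
          by simp [mul_assoc], ← relz, zpow_add]
        simp [mul_assoc]
      simp only [so, Option.bind_some, if_true, tm, Option.map_none]
      rw [e]; exact Wk.tail _ _
    · intro v z z' hv hz e
      grind
    · intro v z hv hz e
      have : z = x := by grind
      subst this
      have : v = a := hA1 v (G'.symm _ _ hz)
      subst this
      exact ⟨1, wkx _⟩
    · intro v hv hv'
      have : v = x := by rw [hV] at hv; simpa [hv'] using hv
      subst this
      exact ⟨⟨a, a, fun z hz => Or.inl (hA1 z hz)⟩, a, (hA _ _).2 (by simp), hav⟩

lemma inner_pair {G G' : WGraph} {a b x : ℕ} (h : IsInnerBlowup G G' a b x) : Pair G G' := by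
  obtain ⟨hab, hx, hV, hA, hW⟩ := h
  have hn := fun v => nadj hx v
  have hav := (G.support _ _ hab).1
  have hbv := (G.support _ _ hab).2
  have hba := G.symm _ _ hab
  have hxa : x ≠ a := by rintro rfl; exact hx hav
  have hxb : x ≠ b := by rintro rfl; exact hx hbv
  have hne : a ≠ b := by rintro rfl; simp [G.loopless] at hab
  have hA1 : ∀ z, G'.adj x z = true → z = a ∨ z = b := by
    intro z hz
    have := (hA x z).1 hz
    have := hn z
    grind
  have hA2 : ∀ v ∈ G.verts, ∀ z ∈ G.verts, (G'.adj v z = true ↔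
      G.adj v z = true ∧ ¬((v = a ∧ z = b) ∨ (v = b ∧ z = a))) := by
    intro v hv z hz
    have h1 : v ≠ x := by rintro rfl; exact hx hv
    have h2 : z ≠ x := by rintro rfl; exact hx hz
    rw [hA]; tauto
  have hA3 : ∀ v ∈ G.verts, (G'.adj v x = true ↔ v = a ∨ v = b) := by
    intro v hv
    have h1 : v ≠ x := by rintro rfl; exact hx hv
    have := hn v
    rw [hA]; tauto
  have wtx : G'.wt x = -1 := by simp [hW]
  have mv : ∀ v ∈ G.verts, v ≠ x := by rintro v hv rfl; exact hx hv
  refine ⟨id, fun v z => if (v = a ∧ z = b) ∨ (v = b ∧ z = a) then some x else some z,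
    fun v z => if (v = a ∧ z = b) ∨ (v = b ∧ z = a) then 1 else 0, (· ∈ G.verts), fun v => ∅,
    id, fun v z => if z = x then (if v = a then some b else some a) else some z,
    fun _ z => if z = x then -1 else 0,
    (· ∈ G.verts), fun _ => ∅, ?_, ?_⟩
  · refine ⟨⟨?_, ?_, ?_, ?_, ?_⟩, fun v h => h, fun v h => ⟨h, rfl⟩, ?_, ?_, fun v h h' => (h' h).elim⟩
    · intro v hv
      have hvx : v ≠ x := mv v hv
      refine ⟨?_, ?_, ?_, ?_⟩
      · intro z'
        simp only [id, Finset.notMem_empty, or_false]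
        constructor
        · intro h
          by_cases hz : z' = x
          · subst hz
            rcases (hA3 v hv).1 h with rfl | rfl
            · exact ⟨b, hab, by simp⟩
            · exact ⟨a, hba, by simp⟩
          · have hz' : z' ∈ G.verts := by
              have := (G'.support _ _ h).2
              rw [hV] at this; simpa [hz] using this
            have := (hA2 v hv z' hz').1 h
            exact ⟨z', this.1, by simp only [this.2, if_false]⟩
        · rintro ⟨z, hz, e⟩
          by_cases hc : (v = a ∧ z = b) ∨ (v = b ∧ z = a)
          · simp only [hc, if_true, Option.some.injEq] at e
            subst e
            exact (hA3 v hv).2 (by tauto)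
          · simp only [hc, if_false, Option.some.injEq] at e
            subst e
            exact (hA2 v hv z (G.support _ _ hz).2).2 ⟨hz, hc⟩
      · intro z1 z2 y h1 h2 e1 e2
        have := mv z1 (G.support _ _ h1).2
        have := mv z2 (G.support _ _ h2).2
        grind
      · simp
      · simp only [id, hW, hvx, if_false, Finset.card_empty]
        have hbm : b ∈ G.verts.filter (fun z => G.adj a z = true) := by simp [hbv, hab]
        have ham : a ∈ G.verts.filter (fun z => G.adj b z = true) := by simp [hav, hba]
        by_cases e : v = a
        · subst e
          simp only [true_and, hne, false_and, or_false]
          rw [Finset.sum_ite_eq', if_pos hbm]; simp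
        · by_cases e' : v = b
          · subst e'
            simp only [true_and, hne.symm, false_and, false_or]
            rw [Finset.sum_ite_eq', if_pos ham]; simp
          · simp [e, e']
    · simp
    · intro p q _ _ _; split_ifs <;> exact ⟨_, rfl⟩
    · rintro X' p q hp hq ha p' e g t h
      by_cases hc : (q = a ∧ p = b) ∨ (q = b ∧ p = a)
      · have hc' : (p = a ∧ q = b) ∨ (p = b ∧ q = a) := by tauto
        simp only [hc, if_true, Option.some.injEq] at e h
        subst e
        simp only [hc', if_true, id] at h ⊢
        refine Wk.step p x (some q) 0 _ _ t ((hA3 p hp).2 (by tauto)) ?_ ?_ h ?_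
        · rintro ⟨⟩; simp [G.loopless] at ha
        · intro z hz h1 h2
          have := hA1 z hz
          grind
        · rw [Wsum_leaf G' (some q) 0 (fun z hz => by have := hA1 z hz; grind), wtx, relA]
      · have hc' : ¬ ((p = a ∧ q = b) ∨ (p = b ∧ q = a)) := by tauto
        simp only [hc, if_false, Option.some.injEq] at e h
        subst e
        simp only [hc', if_false, id] at h ⊢
        simpa using h
    · intro X' p q hp hq ha
      exact (hq (G.support _ _ ha).2).elim
    · intro v z z' hv hz e
      have := mv z (G.support _ _ hz).2
      simp only [id]
      grind
    · intro v z hv hz e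
      grind
  · refine ⟨⟨?_, ?_, ?_, ?_, ?_⟩, fun v h => by simp [hV, h], fun v h => ⟨h, rfl⟩, ?_, ?_, ?_⟩
    · intro v hv
      have hvx : v ≠ x := mv v hv
      refine ⟨?_, ?_, ?_, ?_⟩
      · intro z'
        simp only [id, Finset.notMem_empty, or_false]
        constructor
        · intro h
          have hz' := (G.support _ _ h).2
          by_cases hc : (v = a ∧ z' = b) ∨ (v = b ∧ z' = a)
          · refine ⟨x, (hA3 v hv).2 (by tauto), ?_⟩
            grind
          · exact ⟨z', (hA2 v hv z' hz').2 ⟨h, hc⟩, by simp [mv z' hz']⟩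
        · rintro ⟨z, hz, e⟩
          by_cases e' : z = x
          · subst e'
            have := (hA3 v hv).1 hz
            grind
          · simp only [e', if_false, Option.some.injEq] at e
            subst e
            have hz' : z ∈ G.verts := by
              have := (G'.support _ _ hz).2
              rw [hV] at this; simpa [e'] using this
            exact ((hA2 v hv z hz').1 hz).1
      · intro z1 z2 y h1 h2 e1 e2
        have h3 := hA3 v hv
        have q : ∀ z, G'.adj v z = true → z ≠ x → ¬((v = a ∧ z = b) ∨ (v = b ∧ z = a)) := by
          intro z hz e
          have hz' : z ∈ G.verts := by
              have := (G'.support _ _ hz).2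
              rw [hV] at this; simpa [e] using this
          exact ((hA2 v hv z hz').1 hz).2
        have q1 := q z1 h1
        have q2 := q z2 h2
        clear hA hA1 hA2 hA3 hW q
        grind
      · simp
      · simp only [id, hW, hvx, if_false, Finset.card_empty]
        rw [Finset.sum_ite_eq']
        have e1 : x ∈ G'.verts.filter (fun z => G'.adj v z = true) ↔ v = a ∨ v = b := by
          rw [Finset.mem_filter, hV, hA3 v hv]; simp
        simp only [e1]
        by_cases e : v = a
        · simp [e]
        · by_cases e' : v = b <;> simp [e, e']
    · simp
    · intro p q hp hq _
      exact ⟨p, by simp [mv p hp]⟩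
    · rintro X' p q hp hq ha p' e g t h
      have hpx := mv p hp
      have hqx := mv q hq
      simp only [hpx, if_false, Option.some.injEq] at e
      subst e
      simpa [hpx, hqx] using h
    · intro X' p q hp hq ha y m g t hy h1 h2 h3
      have hqx : q = x := by
        have := (G'.support _ _ ha).2
        rw [hV] at this; simpa [hq] using this
      subst hqx
      obtain ⟨r, hr, hσ1, hσ2, hall, hpr, hxr⟩ : ∃ r, r ∈ G.verts ∧
          (if p = a then some b else some a) = some r ∧
          (if r = a then some b else some a) = some p ∧ (∀ z, G'.adj q z = true → z = p ∨ z = r) ∧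
          r ≠ p ∧ G'.adj q r = true := by
        rcases (hA3 p hp).1 ha with rfl | rfl
        · exact ⟨b, hbv, by simp, by simp [hne.symm], hA1, hne.symm,
            G'.symm _ _ ((hA3 b hbv).2 (by simp))⟩
        · exact ⟨a, hav, by simp [hne.symm], by simp, fun z hz => (hA1 z hz).symm, hne,
            G'.symm _ _ ((hA3 a hav).2 (by simp))⟩
      unfold BC
      simp only [so, Option.bind_some, if_true, hσ1, id]
      rcases y with _ | z
      · obtain ⟨rfl, j, rfl⟩ := h3 rfl
        obtain ⟨j', hj'⟩ := h1 r hxr hpr (by simp) hr p (by simp [hσ2])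
        simp only [if_true, id, neg_neg] at hj'
        refine ⟨-j, ?_⟩
        have e : Wsum G' q (some p) none m = -1 + m r := by
          unfold Wsum
          have : G'.verts.filter (fun z => G'.adj q z = true ∧ some z ≠ some p ∧ some z ≠ none) = {r} := by
            ext z
            have := hall z
            have := (G'.support _ _ hxr).2
            simp only [Finset.mem_filter, Finset.mem_singleton]
            grind
          rw [this, wtx]; simp
        rw [e, zpow_add]
        have := hj'.right rfl (-j')
        have e2 : T ^ (-1:ℤ) * (S * (T ^ (-1:ℤ) * T ^ m r) * (S * T ^ j)) * T ^ (-j) =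
          (T ^ (-1:ℤ) * S * T ^ (-1:ℤ)) * T ^ m r * S := by
          rw [zpow_neg T j]
          simp only [mul_assoc, mul_inv_cancel, mul_one]
        rw [e2, rel2]
        simpa [mul_assoc] using this
      · have hz : z = r := by
          rcases hall z (h2 z rfl).1 with rfl | h
          · exact (hy rfl).elim
          · exact h
        subst hz
        obtain ⟨j', hj'⟩ := (h2 z rfl).2 hr p (by simp [hσ2])
        simp only [if_true, id, neg_neg] at hj'
        refine ⟨j', ?_⟩
        rw [Wsum_leaf G' (some z) m (fun y hy => by have := hall y hy; grind), wtx]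
        have e2 : T ^ (-1:ℤ) * (S * T ^ (-1:ℤ) * g) * T ^ j' =
          (T ^ (-1:ℤ) * S * T ^ (-1:ℤ)) * g * T ^ j' := by
          simp only [mul_assoc]
        rw [e2, rel2]
        exact hj'
    · intro v z z' hv hz e
      have h3 := hA3 v hv
      by_cases e' : z = x
      · subst e'
        have := h3.1 hz
        simp only [id]
        grind
      · have hz' : z ∈ G.verts := by
          have := (G'.support _ _ hz).2
          rw [hV] at this; simpa [e'] using this
        have := ((hA2 v hv z hz').1 hz).2
        simp only [e', if_false, Option.some.injEq] at e
        subst e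
        simp only [id, this, if_false]
    · intro v z hv hz e
      grind
    · intro v hv hv'
      have : v = x := by rw [hV] at hv; simpa [hv'] using hv
      subst this
      exact ⟨⟨a, b, hA1⟩, a, G'.symm _ _ ((hA3 a hav).2 (by simp)), hav⟩

lemma pair_ind {R : WGraph → WGraph → Prop} (hp : ∀ G G', Pair G G' → R G G')
    (hr : ∀ G, R G G) (ht : ∀ G G' G'', R G G' → R G' G'' → R G G'')
    (hs : ∀ G G', R G G' → R G' G) {G G'} (h : BirEq G G') : R G G' := by
  have hb : ∀ G G', BlowupStep G G' → Pair G G' := by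
    rintro G G' (⟨u, v, x, h⟩ | ⟨v, x, h⟩)
    · exact inner_pair h
    · exact outer_pair h
  unfold BirEq at h
  induction h with
  | rel G G' h =>
    rcases h with (h | h) | h
    · exact hp _ _ (hb _ _ h)
    · exact hp _ _ (hb _ _ h).symm
    · exact hp _ _ (iso_pair h)
  | refl G => exact hr G
  | symm G G' _ ih => exact hs _ _ ih
  | trans G G' G'' _ _ h1 h2 => exact ht _ _ _ h1 h2

theorem rel_of_birEq {G G'} (h : BirEq G G') : Rel G G' :=
  pair_ind (fun _ _ h => h.rel) Rel.refl (fun _ _ _ => Rel.trans) (fun _ _ => Rel.symm) h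

end WG


set_option linter.all false

namespace WG
open WGraph

lemma Wsum_symm (G : WGraph) (v o1 o2 m) : Wsum G v o1 o2 m = Wsum G v o2 o1 m := by
  unfold Wsum
  congr 2
  ext z
  simp only [Finset.mem_filter]
  tauto

def FullAt (G : WGraph) (v : ℕ) (h : HH) : Prop :=
  ∃ o1 o2 m g1 g2, (∀ z, o1 = some z → o2 ≠ some z) ∧ Wk G bot v o1 g1 none ∧
    Wk G bot v o2 g2 none ∧
    (∀ z, G.adj v z = true → some z ≠ o1 → some z ≠ o2 →
      Wk G bot v (some z) (T ^ (m z) * S) none) ∧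
    h = rho g1 * T ^ (Wsum G v o1 o2 m) * g2

lemma FullAt.swap {G v h} (hf : FullAt G v h) : FullAt G v (rho h) := by
  obtain ⟨o1, o2, m, g1, g2, h1, h2, h3, h4, rfl⟩ := hf
  refine ⟨o2, o1, m, g2, g1, fun z a b => h1 z b a, h3, h2, fun z a b c => h4 z a c b, ?_⟩
  rw [rho_mul, rho_mul, rho_rho, rho_T, Wsum_symm, mul_assoc]

lemma FullAt.swap_iff {G v h} : FullAt G v (rho h) ↔ FullAt G v h :=
  ⟨fun hf => by simpa [rho_rho] using hf.swap, FullAt.swap⟩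

lemma FullAt.sim {G G' f σ s P ex} (h : Sim G G' f σ s P ex) {v x} (hv : P v)
    (hf : FullAt G v x) : FullAt G' (f v) x := by
  obtain ⟨o1, o2, m, g1, g2, h1, h2, h3, h4, rfl⟩ := hf
  have hls := h.ls v hv
  have hm : ∀ {o g}, Wk G bot v o g none → Wk G' bot (f v) (o.bind (σ v)) (T ^ so (s v) o * g) none := by
    intro o g hw
    obtain ⟨j, hj⟩ := (h.main (X' := bot) (fun q p h => h.elim) hw).1 hv
    have := hj.right rfl (-j)
    simpa [mul_assoc, tm] using this
  obtain ⟨m', hm1, hm2⟩ := cfg hls o1 o2 (fun z => h2.adj z) (fun z => h3.adj z) h1 m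
    (fun z k => Wk G' bot (f v) (some z) (T ^ k * S) none)
    (by
      intro z hz1 hz2 hz3
      have hj := hm (h4 z hz1 hz2 hz3)
      constructor
      · intro z' hz'
        simp only [Option.bind_some, hz', so] at hj
        rw [add_comm, zpow_add, mul_assoc]; exact hj
      · intro hz'
        simp only [Option.bind_some, hz', so] at hj
        obtain ⟨_, j', hj'⟩ := hj.tail_inv
        rw [add_comm]
        apply TS_inj (i := 0) (j := j')
        rw [← hj', zpow_add]; simp [mul_assoc])
    (h.exT bot v hv)
  refine ⟨o1.bind (σ v), o2.bind (σ v), m', _, _, ?_, hm h2, hm h3, hm1, ?_⟩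
  · intro z' e1 e2
    rw [Option.bind_eq_some_iff] at e1 e2
    obtain ⟨a, ha, ha'⟩ := e1
    obtain ⟨b, hb, hb'⟩ := e2
    exact h1 a ha (by rw [hb, hls.inj a b z' (h2.adj a ha) (h3.adj b hb) ha' hb'])
  · rw [hm2, rho_mul, rho_T]
    rw [show Wsum G v o1 o2 m - so (s v) o1 - so (s v) o2 =
      - so (s v) o1 + Wsum G v o1 o2 m + - so (s v) o2 by ring, zpow_add, zpow_add]
    simp [mul_assoc]

lemma FullAt.promote {G v u h} (htw : Two G v) (ha : G.adj v u = true) (hf : FullAt G v h) :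
    ∃ h', (h' = h ∨ h' = rho h) ∧ ∃ o1 m g1 g2, o1 ≠ some u ∧ Wk G bot v o1 g1 none ∧
    Wk G bot v (some u) g2 none ∧
    (∀ z, G.adj v z = true → some z ≠ o1 → some z ≠ some u →
      Wk G bot v (some z) (T ^ (m z) * S) none) ∧
    h' = rho g1 * T ^ (Wsum G v o1 (some u) m) * g2 := by
  obtain ⟨o1, o2, m, g1, g2, h1, h2, h3, h4, rfl⟩ := hf
  have key : ∀ o1 g1 g2 m, o1 ≠ some u → Wk G bot v o1 g1 none → Wk G bot v none g2 none →
      (∀ z, G.adj v z = true → some z ≠ o1 → some z ≠ none →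
      Wk G bot v (some z) (T ^ (m z) * S) none) → ∃ g2', Wk G bot v (some u) g2' none ∧
      rho g1 * T ^ (Wsum G v o1 none m) * g2 = rho g1 * T ^ (Wsum G v o1 (some u) m) * g2' := by
    intro o1 g1 g2 m hne h2 h3 h4
    obtain ⟨_, j, rfl⟩ := h3.tail_inv
    refine ⟨T ^ (m u) * S * T ^ j, (h4 u ha hne.symm (by simp)).right rfl j, ?_⟩
    have : Wsum G v o1 none m = Wsum G v o1 (some u) m + m u := by
      unfold Wsum
      have hu : u ∈ G.verts.filter (fun z => G.adj v z = true ∧ some z ≠ o1 ∧ some z ≠ none) := by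
        simp [ha, (G.support _ _ ha).2, hne.symm]
      rw [← Finset.sum_erase_add _ _ hu]
      have : (G.verts.filter (fun z => G.adj v z = true ∧ some z ≠ o1 ∧ some z ≠ none)).erase u =
        G.verts.filter (fun z => G.adj v z = true ∧ some z ≠ o1 ∧ some z ≠ some u) := by
        ext z; simp; tauto
      rw [this]; ring
    rw [this, zpow_add]; simp [mul_assoc]
  by_cases e2 : o2 = some u
  · subst e2
    exact ⟨_, Or.inl rfl, o1, m, g1, g2, fun e => h1 u e rfl, h2, h3, h4, rfl⟩
  have hrho : rho (rho g1 * T ^ (Wsum G v o1 o2 m) * g2) = rho g2 * T ^ (Wsum G v o2 o1 m) * g1 := by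
    rw [rho_mul, rho_mul, rho_rho, rho_T, Wsum_symm, mul_assoc]
  by_cases e1 : o1 = some u
  · subst e1
    exact ⟨_, Or.inr rfl, o2, m, g2, g1, e2, h3, h2, fun z a b c => h4 z a c b, hrho⟩
  rcases o2 with _ | b
  · obtain ⟨g2', k1, k2⟩ := key o1 g1 g2 m e1 h2 h3 h4
    exact ⟨_, Or.inl rfl, o1, m, g1, g2', e1, h2, k1, fun z a b c => h4 z a b (by simp), k2⟩
  rcases o1 with _ | a
  · obtain ⟨g2', k1, k2⟩ := key (some b) g2 g1 m e2 h3 h2 (fun z a b c => h4 z a c b)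
    exact ⟨_, Or.inr rfl, some b, m, g2, g2', e2, h3, k1, fun z a b c => h4 z a (by simp) b,
      hrho.trans k2⟩
  exfalso
  obtain ⟨c, d, hcd⟩ := htw
  have := hcd _ (h2.adj a rfl); have := hcd _ (h3.adj b rfl); have := hcd _ ha
  have := h1 a rfl
  grind

lemma FullAt.move {G v u h} (htw : Two G v) (ha : G.adj v u = true) (hf : FullAt G v h) :
    FullAt G u h := by
  obtain ⟨h', hh, o1, m, g1, g2, n1, h1, h2, h3, e⟩ := hf.promote htw ha
  suffices FullAt G u h' by
    rcases hh with rfl | rfl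
    · exact this
    · exact FullAt.swap_iff.1 this
  cases h2 with
  | step _ _ y m' g _ _ a1 a2 a3 a4 a5 =>
    refine ⟨some v, y, m', S * T ^ (Wsum G v (some u) o1 m) * g1, g, ?_, ?_, a4, ?_, ?_⟩
    · rintro z ⟨⟩; exact a2
    · exact Wk.step u v o1 m g1 _ none (G.symm _ _ ha) n1
        (fun z hz b1 b2 => h3 z hz b2 (by simpa using b1)) h1 rfl
    · intro z hz b1 b2
      exact a3 z hz (by simpa using b1) b2
    · rw [e, a5, rho_mul, rho_mul, rho_T, rho_S, Wsum_symm G v (some u)]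
      simp only [mul_assoc]

def Full (G : WGraph) (h : HH) : Prop := ∃ v ∈ G.verts, FullAt G v h

lemma Pair.full {G G'} (hp : Pair G G') {h} (hf : Full G h) : Full G' h := by
  obtain ⟨f, σ, s, P, ex, f', σ', s', P', ex', h1, h2⟩ := hp
  obtain ⟨v, hv, hf⟩ := hf
  by_cases hP : P v
  · exact ⟨f v, h2.pv _ (h1.inv1 v hP).1, hf.sim h1.sim hP⟩
  · obtain ⟨htw, u, ha, hu⟩ := h1.out v hv hP
    exact ⟨f u, h2.pv _ (h1.inv1 u hu).1, (hf.move htw ha).sim h1.sim hu⟩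

theorem full_of_birEq {G G'} (h : BirEq G G') : ∀ x, Full G x ↔ Full G' x :=
  pair_ind (R := fun G G' => ∀ x, Full G x ↔ Full G' x)
    (fun _ _ h x => ⟨h.full, h.symm.full⟩) (fun _ _ => Iff.rfl)
    (fun _ _ _ h h' x => (h x).trans (h' x)) (fun _ _ h x => (h x).symm) h

end WG


set_option linter.all false

namespace WG
open WGraph

inductive SP (G : WGraph) : ℕ → ℕ → List ℕ → Option (ℕ × ℕ) → Prop
  | node (u v) : G.adj u v = true → G.Branch v → SP G u v [] (some (v, u))
  | leaf (u v) : G.adj u v = true → ¬ G.Branch v → (∀ z, G.adj v z = true → z = u) →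
      SP G u v [v] none
  | step (u v y l t) : G.adj u v = true → ¬ G.Branch v → G.adj v y = true → y ≠ u →
      (∀ z, G.adj v z = true → z = u ∨ z = y) → SP G v y l t → SP G u v (v :: l) t

lemma SP.adj {G u v l t} (h : SP G u v l t) : G.adj u v = true := by
  cases h <;> assumption

lemma nb_two {G : WGraph} {v a b : ℕ} (h : ¬ G.Branch v) (ha : G.adj v a = true)
    (hb : G.adj v b = true) (hab : a ≠ b) : ∀ z, G.adj v z = true → z = a ∨ z = b := by
  intro z hz
  by_contra hc
  push Not at hc
  apply h
  refine ⟨(G.support _ _ ha).1, ?_⟩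
  have : ({a, b, z} : Finset ℕ) ⊆ G.verts.filter (fun u => G.adj v u = true) := by
    intro y hy
    simp only [Finset.mem_insert, Finset.mem_singleton] at hy
    rw [Finset.mem_filter]
    rcases hy with rfl | rfl | rfl
    · exact ⟨(G.support _ _ ha).2, ha⟩
    · exact ⟨(G.support _ _ hb).2, hb⟩
    · exact ⟨(G.support _ _ hz).2, hz⟩
  have h2 := Finset.card_le_card this
  rw [Finset.card_eq_three.2 ⟨a, b, z, hab, hc.1.symm, hc.2.symm, rfl⟩] at h2
  exact h2

lemma two_of_nb {G : WGraph} {v : ℕ} (h : ¬ G.Branch v) : Two G v := by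
  by_cases h1 : ∃ a b, G.adj v a = true ∧ G.adj v b = true ∧ a ≠ b
  · obtain ⟨a, b, ha, hb, hab⟩ := h1
    exact ⟨a, b, nb_two h ha hb hab⟩
  · by_cases h2 : ∃ a, G.adj v a = true
    · obtain ⟨a, ha⟩ := h2
      refine ⟨a, a, fun z hz => Or.inl ?_⟩
      by_contra hc
      exact h1 ⟨z, a, hz, ha, hc⟩
    · exact ⟨0, 0, fun z hz => (h2 ⟨z, hz⟩).elim⟩

lemma branch_three {G : WGraph} {v : ℕ} (h : G.Branch v) : ∃ z1 z2 z3, z1 ≠ z2 ∧ z1 ≠ z3 ∧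
    z2 ≠ z3 ∧ G.adj v z1 = true ∧ G.adj v z2 = true ∧ G.adj v z3 = true := by
  obtain ⟨t, ht1, ht2⟩ := Finset.exists_subset_card_eq h.2
  obtain ⟨a, b, c, h1, h2, h3, rfl⟩ := Finset.card_eq_three.1 ht2
  refine ⟨a, b, c, h1, h2, h3, ?_, ?_, ?_⟩
  · exact (Finset.mem_filter.1 (ht1 (by simp))).2
  · exact (Finset.mem_filter.1 (ht1 (by simp))).2
  · exact (Finset.mem_filter.1 (ht1 (by simp))).2

lemma branch_not_two {G : WGraph} {v : ℕ} (h : G.Branch v) (h2 : Two G v) : False := by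
  obtain ⟨a, b, c, h1, h2', h3, e1, e2, e3⟩ := branch_three h
  obtain ⟨p, q, hpq⟩ := h2
  have := hpq _ e1; have := hpq _ e2; have := hpq _ e3
  grind

lemma mem_NB {G : WGraph} {v : ℕ} : v ∈ G.NB ↔ v ∈ G.verts ∧ ¬ G.Branch v := by
  unfold NB Branch
  simp only [Set.mem_setOf_eq]
  constructor
  · rintro ⟨h1, h2⟩; exact ⟨h1, fun h => by omega⟩
  · rintro ⟨h1, h2⟩; exact ⟨h1, by by_contra hc; exact h2 ⟨h1, by omega⟩⟩

lemma SP.det {G u v l t l' t'} (h : SP G u v l t) (h' : SP G u v l' t') : l = l' ∧ t = t' := by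
  induction h generalizing l' t' with
  | node u v a b => cases h' <;> simp_all
  | leaf u v a b c =>
    cases h' with
    | node => simp_all
    | leaf => simp
    | step _ _ y l _ h1 h2 h3 h4 h5 => exact (h4 (c _ h3)).elim
  | step u v y l t a b c d e f ih =>
    cases h' with
    | node => simp_all
    | leaf _ _ g1 g2 g3 => exact (d (g3 _ c)).elim
    | step _ _ y' l _ h1 h2 h3 h4 h5 h6 =>
      have : y = y' := by
        rcases e _ h3 with e | e
        · exact (h4 e).elim
        · exact e.symm
      subst this
      obtain ⟨rfl, rfl⟩ := ih h6
      simp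

lemma SP.head {G u v l t} (h : SP G u v l t) (hb : ¬ G.Branch v) : ∃ l', l = v :: l' := by
  cases h with
  | node => exact (hb ‹_›).elim
  | leaf => exact ⟨_, rfl⟩
  | step => exact ⟨_, rfl⟩

lemma SP.head0 {G u v l t} (h : SP G u v l t) {a} (h0 : l[0]? = some a) : a = v := by
  cases h with
  | node => simp at h0
  | leaf => simpa using h0.symm
  | step => simpa using h0.symm

lemma SP.nil {G u v t} (h : SP G u v [] t) : G.Branch v ∧ t = some (v, u) := by
  cases h; exact ⟨‹_›, rfl⟩

lemma SP.term {G u v l t} (h : SP G u v l t) : ∀ x, t = some x → G.Branch x.1 ∧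
    G.adj x.1 x.2 = true := by
  induction h with
  | node u v a b => rintro x ⟨⟩; exact ⟨b, G.symm _ _ a⟩
  | leaf => simp
  | step => assumption

lemma SP.mem {G u v l t} (h : SP G u v l t) : ∀ x ∈ l, ¬ G.Branch x ∧ x ∈ G.verts := by
  induction h with
  | node u v a b => simp
  | leaf u v a b => intro x hx; rw [List.mem_singleton] at hx; subst hx; exact ⟨b, (G.support _ _ a).2⟩
  | step u v y l t a b c d e f ih =>
    intro x hx
    rcases List.mem_cons.1 hx with rfl | hx
    · exact ⟨b, (G.support _ _ a).2⟩
    · exact ih x hx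

lemma SP.rev {G u v l t} (h : SP G u v l t) : ∀ b' u' acc r, t = some (b', u') → SP G v u acc r →
    SP G b' u' (l.reverse ++ acc) r := by
  induction h with
  | node u v a b => rintro b' u' acc r ⟨⟩ h; simpa using h
  | leaf => rintro b' u' acc r ⟨⟩
  | step u v y l t a b c d e f ih =>
    intro b' u' acc r ht h
    have := ih b' u' (v :: acc) r ht (SP.step y v u acc r (G.symm _ _ c) b (G.symm _ _ a) d.symm
      (fun z hz => (e z hz).symm) h)
    simpa using this

lemma SP.reverse {G b u l b' u'} (h : SP G b u l (some (b', u'))) (hb : G.Branch b) :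
    SP G b' u' l.reverse (some (b, u)) := by
  have := h.rev b' u' [] _ rfl (SP.node u b (G.symm _ _ h.adj) hb)
  simpa using this

lemma SP.last {G p u l t} (h : SP G p u l t) : ∀ z b, l.getLast? = some z → G.adj z b = true →
    G.Branch b → (2 ≤ l.length ∨ b ≠ p) → t = some (b, z) := by
  induction h with
  | node => simp
  | leaf u v a b c =>
    intro z b hz hb1 hb2 h
    simp at hz h
    subst hz
    exact (h (c _ hb1)).elim
  | step u v y l t a b c d e f ih =>
    intro z b' hz hb1 hb2 h
    rcases l with _ | ⟨w, l⟩
    · simp at hz h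
      subst hz
      obtain ⟨k1, rfl⟩ := f.nil
      rcases e _ hb1 with e | e
      · exact (h e).elim
      · rw [e]
    · refine ih z b' (by simpa using hz) hb1 hb2 (Or.inr ?_)
      rintro rfl; exact b hb2

lemma SP.nbr {G p u l t} (h : SP G p u l t) : ∀ i v w, l[i]? = some v → G.adj v w = true →
    (i = 0 ∧ w = p) ∨ (∃ j, i = j + 1 ∧ l[j]? = some w) ∨ l[i+1]? = some w ∨ G.Branch w := by
  induction h with
  | node => simp
  | leaf u v a b c =>
    intro i v' w hi ha
    rcases i with _ | i
    · simp at hi; subst hi; exact Or.inl ⟨rfl, c _ ha⟩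
    · simp at hi
  | step u v y l t a b c d e f ih =>
    intro i v' w hi ha
    rcases i with _ | i
    · simp at hi; subst hi
      rcases e _ ha with rfl | rfl
      · simp
      · by_cases hw : G.Branch w
        · simp [hw]
        · obtain ⟨l', rfl⟩ := f.head hw
          simp
    · simp only [List.getElem?_cons_succ] at hi ⊢
      rcases ih i v' w hi ha with ⟨rfl, rfl⟩ | ⟨j, rfl, hj⟩ | h | h
      · simp
      · right; left; exact ⟨j + 1, rfl, by simpa using hj⟩
      · simp [h]
      · simp [h]

lemma SP.chain {G p u l t} (h : SP G p u l t) : ∀ i v w, l[i]? = some v → l[i+1]? = some w →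
    G.adj v w = true := by
  induction h with
  | node => simp
  | leaf => simp
  | step u v y l t a b c d e f ih =>
    intro i v' w hi hw
    rcases i with _ | i
    · simp at hi hw; subst hi
      rw [f.head0 hw]
      exact c
    · simp only [List.getElem?_cons_succ] at hi hw
      exact ih i v' w hi hw

lemma sp_of_list {G : WGraph} : ∀ (rest : List ℕ) (u p : ℕ), (u :: rest).Nodup →
    List.IsChain (fun a b => G.adj a b = true) (u :: rest) → (∀ v ∈ u :: rest, ¬ G.Branch v) →
    G.adj p u = true → p ∉ u :: rest →
    (∀ v ∈ u :: rest, ∀ w, G.adj v w = true → G.Branch w ∨ w ∈ u :: rest ∨ (w = p ∧ v = u)) →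
    ∃ t, SP G p u (u :: rest) t := by
  intro rest
  induction rest with
  | nil =>
    intro u p hn hc hb ha hp hcl
    have hbu := hb u (by simp)
    by_cases h : ∀ z, G.adj u z = true → z = p
    · exact ⟨none, SP.leaf _ _ ha hbu h⟩
    · push Not at h
      obtain ⟨w, hw, hwp⟩ := h
      have hbw : G.Branch w := by
        rcases hcl u (by simp) w hw with h | h | h
        · exact h
        · simp at h; subst h; simp [G.loopless] at hw
        · exact (hwp h.1).elim
      exact ⟨_, SP.step p u w [] _ ha hbu hw hwp (nb_two hbu (G.symm _ _ ha) hw hwp.symm)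
        (SP.node _ _ hw hbw)⟩
  | cons y rest ih =>
    intro u p hn hc hb ha hp hcl
    have hbu := hb u (by simp)
    rw [List.isChain_cons_cons] at hc
    have hyp : y ≠ p := by rintro rfl; simp at hp
    have htw := nb_two hbu (G.symm _ _ ha) hc.1 hyp.symm
    have hn' := List.nodup_cons.1 hn
    obtain ⟨t, ht⟩ := ih y u hn'.2 hc.2 (fun v hv => hb v (List.mem_cons_of_mem _ hv)) hc.1
      hn'.1 (by
        intro v hv w hw
        rcases hcl v (List.mem_cons_of_mem _ hv) w hw with h | h | h
        · exact Or.inl h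
        · rcases List.mem_cons.1 h with rfl | h
          · rcases htw v (G.symm _ _ hw) with rfl | rfl
            · exact (hp (List.mem_cons_of_mem _ hv)).elim
            · exact Or.inr (Or.inr ⟨rfl, rfl⟩)
          · exact Or.inr (Or.inl h)
        · exact (hn'.1 (h.2 ▸ hv)).elim)
    exact ⟨t, SP.step p u y _ t ha hbu hc.1 hyp htw ht⟩

end WG


set_option linter.all false

namespace WG
open WGraph

lemma SP.wk {G : WGraph} {X : ℕ → ℕ → Prop} (hX : ∀ b u, G.Branch b → G.adj b u = true → X b u)
    {u v l t} (h : SP G u v l t) : Wk G X u (some v) (lab (l.map G.wt)) t := by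
  induction h with
  | node u v a b => exact Wk.node u v a (hX _ _ b (G.symm _ _ a))
  | leaf u v a b c =>
    refine Wk.step u v none 0 (S * T ^ (0:ℤ)) _ none a (by simp) ?_ (Wk.tail _ _) ?_
    · intro z hz h1 _; exact (h1 (c z hz)).elim
    · rw [Wsum_leaf G none 0 (fun z hz => Or.inl (c z hz))]
      simp [lab]
  | step u v y l t a b c d e f ih =>
    refine Wk.step u v (some y) 0 _ _ t a (by simpa using d) ?_ ih ?_
    · intro z hz h1 h2
      rcases e z hz with h | h
      · exact (h1 h).elim
      · exact (h2 (by rw [h])).elim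
    · rw [Wsum_leaf G (some y) 0 (fun z hz => by simpa using e z hz)]
      simp [lab]

def Tip (G : WGraph) : Prop := ∀ b u l, G.Branch b → SP G b u l none → ∀ m j : ℤ,
    lab (l.map G.wt) * T ^ j ≠ T ^ m * S

lemma shape {G : WGraph} {X : ℕ → ℕ → Prop} (hX : ∀ b u, X b u → G.Branch b) (hT : Tip G)
    {u o g t} (h : Wk G X u o g t) : ∀ v, o = some v →
    ∃ l, ∃ j : ℤ, SP G u v l t ∧ g = lab (l.map G.wt) * T ^ j := by
  induction h with
  | tail => simp
  | node u v a b => rintro v' ⟨⟩; exact ⟨[], 0, SP.node u v a (hX _ _ b), by simp [lab]⟩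
  | step u v y m g g' t a hy hz hw e ih1 ih2 =>
    rintro v' ⟨⟩
    by_cases hb : G.Branch v
    · exfalso
      obtain ⟨z, h1, h2, h3⟩ : ∃ z, G.adj v z = true ∧ z ≠ u ∧ some z ≠ y := by
        by_contra hc
        push Not at hc
        refine branch_not_two hb ⟨u, y.getD 0, fun z hz => ?_⟩
        by_cases hzu : z = u
        · exact Or.inl hzu
        · right; rw [← hc z hz hzu]; rfl
      obtain ⟨l, j, h4, h5⟩ := ih1 z h1 h2 h3 z rfl
      exact hT v z l hb h4 _ _ h5.symm
    · rcases y with _ | y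
      · obtain ⟨rfl, j, rfl⟩ := hw.tail_inv
        by_cases hl : ∀ z, G.adj v z = true → z = u
        · refine ⟨[v], j, SP.leaf u v a hb hl, ?_⟩
          rw [e, Wsum_leaf G none m (fun z hz => Or.inl (hl z hz))]
          simp [lab, mul_assoc]
        · push Not at hl
          obtain ⟨w, hw1, hw2⟩ := hl
          have htw := nb_two hb (G.symm _ _ a) hw1 hw2.symm
          obtain ⟨l, i, h4, h5⟩ := ih1 w hw1 hw2 (by simp) w rfl
          refine ⟨v :: l, i + j, SP.step u v w l _ a hb hw1 hw2 htw h4, ?_⟩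
          have : Wsum G v (some u) none m = G.wt v + m w := by
            unfold Wsum
            have : G.verts.filter (fun z => G.adj v z = true ∧ some z ≠ some u ∧ some z ≠ none) = {w} := by
              ext z
              have := htw z
              have := (G.support _ _ hw1).2
              simp only [Finset.mem_filter, Finset.mem_singleton]
              grind
            rw [this]; simp
          rw [e, this, zpow_add, zpow_add]
          have e2 : S * (T ^ G.wt v * T ^ m w) * (S * T ^ j) =
            S * T ^ G.wt v * (T ^ m w * S) * T ^ j := by simp only [mul_assoc]
          rw [e2, h5]
          simp [lab, mul_assoc]
      · obtain ⟨l, i, h4, h5⟩ := ih2 y rfl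
        have hyu : y ≠ u := fun e => hy (by rw [e])
        have hvy := hw.adj y rfl
        have htw := nb_two hb (G.symm _ _ a) hvy hyu.symm
        refine ⟨v :: l, i, SP.step u v y l _ a hb hvy hyu htw h4, ?_⟩
        rw [e, Wsum_leaf G (some y) m (fun z hz => by simpa using htw z hz), h5]
        simp [lab, mul_assoc]

def segOf (G : WGraph) (v : ℕ) : Set ℕ := {u | Relation.ReflTransGen
    (fun a b => a ∈ G.NB ∧ b ∈ G.NB ∧ G.adj a b = true) v u}

lemma segOf_seg {G : WGraph} {v} (h : v ∈ G.NB) : G.IsSegment (segOf G v) := ⟨v, h, rfl⟩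

lemma seg_nb {G : WGraph} {S} (h : G.IsSegment S) : ∀ u ∈ S, u ∈ G.NB := by
  obtain ⟨v, hv, rfl⟩ := h
  intro u hu
  rcases Relation.ReflTransGen.cases_tail hu with h | ⟨c, _, h⟩
  · rw [← h] at hv; exact hv
  · exact h.2.1

lemma seg_closed {G : WGraph} {S} (h : G.IsSegment S) {u w} (hu : u ∈ S) (ha : G.adj u w = true)
    (hw : ¬ G.Branch w) : w ∈ S := by
  have hu' := seg_nb h u hu
  obtain ⟨v, hv, rfl⟩ := h
  exact Relation.ReflTransGen.tail hu ⟨hu', mem_NB.2 ⟨(G.support _ _ ha).2, hw⟩, ha⟩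

lemma seg_eq {G : WGraph} {S u} (h : G.IsSegment S) (hu : u ∈ S) : S = segOf G u := by
  obtain ⟨v, hv, rfl⟩ := h
  have sy : ∀ a b, Relation.ReflTransGen
    (fun a b => a ∈ G.NB ∧ b ∈ G.NB ∧ G.adj a b = true) a b → Relation.ReflTransGen
    (fun a b => a ∈ G.NB ∧ b ∈ G.NB ∧ G.adj a b = true) b a := by
    intro a b h
    induction h with
    | refl => exact .refl
    | tail _ h ih => exact Relation.ReflTransGen.head ⟨h.2.1, h.1, G.symm _ _ h.2.2⟩ ih
  ext w
  exact ⟨fun h => (sy _ _ hu).trans h, fun h => Relation.ReflTransGen.trans hu h⟩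

lemma segList_rev {G : WGraph} {S l} (h : G.SegList S l) : G.SegList S l.reverse := by
  obtain ⟨h1, h2, h3⟩ := h
  refine ⟨List.nodup_reverse.2 h1, fun v => by rw [List.mem_reverse]; exact h2 v, ?_⟩
  unfold List.Chain' at *
  rw [List.isChain_reverse]
  exact h3.imp (fun a b h => G.symm _ _ h)

/-- the vertex is at an end of the list -/
lemma at_end {G : WGraph} {S l u} (hl : G.SegList S l) (hu : u ∈ S)
    (hd : ∀ x y, G.adj u x = true → G.adj u y = true → x ∈ l → y ∈ l → x = y) :
    (∃ r, l = u :: r) ∨ (∃ r, l.reverse = u :: r) := by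
  obtain ⟨h1, h2, h3⟩ := hl
  obtain ⟨s, t, rfl⟩ := List.append_of_mem ((h2 u).2 hu)
  rcases t with _ | ⟨y, t⟩
  · right; exact ⟨s.reverse, by simp⟩
  · rcases List.eq_nil_or_concat s with rfl | ⟨s, x, rfl⟩
    · left; exact ⟨_, rfl⟩
    · exfalso
      unfold List.Chain' at h3
      have e : s ++ [x] ++ u :: y :: t = s ++ (x :: u :: y :: t) := by simp
      simp only [List.concat_eq_append] at *
      rw [e] at h3 h1
      have h4 := h3.right_of_append
      rw [List.isChain_cons_cons, List.isChain_cons_cons] at h4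
      have := hd x y (G.symm _ _ h4.1) h4.2.1 (by simp) (by simp)
      subst this
      have h5 := h1.of_append_right
      simp at h5

lemma exist {G : WGraph} {S l u b} (hS : G.IsSegment S) (hl : G.SegList S l) (hu : u ∈ S)
    (hb : G.Branch b) (ha : G.adj b u = true) : ∃ l0, (l0 = l ∨ l0 = l.reverse) ∧
      G.SegList S l0 ∧ ∃ t, SP G b u l0 t := by
  have hnb : ∀ l0, G.SegList S l0 → ∀ v ∈ l0, ¬ G.Branch v := fun l0 h v hv =>
    (mem_NB.1 (seg_nb hS v ((h.2.1 v).1 hv))).2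
  have hbl : ∀ l0, G.SegList S l0 → b ∉ l0 := fun l0 h hv => hnb l0 h b hv hb
  have hun := (mem_NB.1 (seg_nb hS u hu)).2
  have key : ∀ l0, G.SegList S l0 → (∃ r, l0 = u :: r) → ∃ t, SP G b u l0 t := by
    rintro l0 h ⟨r, rfl⟩
    refine sp_of_list r u b h.1 h.2.2 (hnb _ h) ha (hbl _ h) ?_
    intro v hv w hw
    by_cases hwb : G.Branch w
    · exact Or.inl hwb
    · exact Or.inr (Or.inl ((h.2.1 w).2 (seg_closed hS ((h.2.1 v).1 hv) hw hwb)))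
  have hab := G.symm _ _ ha
  rcases at_end hl hu (by
    intro x y hx hy hxl hyl
    by_contra hxy
    have hxb : x ≠ b := by rintro rfl; exact hbl l hl hxl
    have hyb : y ≠ b := by rintro rfl; exact hbl l hl hyl
    rcases nb_two hun hx hy hxy b hab with h | h
    · exact hxb h.symm
    · exact hyb h.symm) with h | h
  · exact ⟨l, Or.inl rfl, hl, key l hl h⟩
  · exact ⟨l.reverse, Or.inr rfl, segList_rev hl, key _ (segList_rev hl) h⟩

lemma std2_of {m : List ℤ} (h : StdSeq m) : Std2 m ∧ Std2 m.reverse :=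
  ⟨Or.inl h, Or.inr (by simpa using h)⟩

lemma sp_dart {G : WGraph} (h : IsStandard G) {b u} (hb : G.Branch b) (ha : G.adj b u = true) :
    ∃ l t, SP G b u l t ∧ Std2 (l.map G.wt) ∧ (¬ G.Branch u → G.SegList (segOf G u) l) := by
  by_cases hu : G.Branch u
  · exact ⟨[], _, SP.node _ _ ha hu, Or.inl (Or.inl (by simp)), fun h => (h hu).elim⟩
  · have hu' : u ∈ G.NB := mem_NB.2 ⟨(G.support _ _ ha).2, hu⟩
    obtain ⟨l, h1, h2, _⟩ := h.2 _ (segOf_seg hu')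
    obtain ⟨l0, h3, h4, t, h5⟩ := exist (segOf_seg hu') h1 (.refl) hb ha
    refine ⟨l0, t, h5, ?_, fun _ => h4⟩
    rcases h3 with rfl | rfl
    · exact (std2_of h2).1
    · rw [List.map_reverse]; exact (std2_of h2).2

lemma tip {G : WGraph} (h : IsStandard G) : Tip G := by
  intro b u l hb hs m j e
  obtain ⟨l', t, h1, h2, _⟩ := sp_dart h hb hs.adj
  obtain ⟨rfl, rfl⟩ := hs.det h1
  have := (lab_main h2 (m' := []) (Or.inl (Or.inl (by simp))) m (-j) (by
    rw [show lab [] = S from rfl, ← e]; simp)).1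
  simp at this
  subst this
  have := h1.nil
  simp at this

lemma xx_iff {G : WGraph} (h : IsStandard G) {b u} : XX G b u ↔ G.Branch b ∧ G.adj b u = true := by
  constructor
  · rintro ⟨h1, h2, z1, z2, z3, n12, n13, n23, a1, a2, a3⟩
    refine ⟨?_, h1⟩
    by_contra hb
    obtain ⟨c, d, hcd⟩ := two_of_nb hb
    have := hcd _ a1.1; have := hcd _ a2.1; have := hcd _ a3.1
    grind
  · rintro ⟨hb, ha⟩
    have nt : ∀ z, ¬ Triv G b z := by
      rintro z ⟨m, hm⟩
      obtain ⟨l, j, h1, h2⟩ := shape (fun _ _ h => h.elim) (tip h) hm z rfl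
      exact tip h b z l hb h1 _ _ h2.symm
    obtain ⟨z1, z2, z3, n12, n13, n23, a1, a2, a3⟩ := branch_three hb
    exact ⟨ha, nt _, z1, z2, z3, n12, n13, n23, ⟨a1, nt _⟩, ⟨a2, nt _⟩, ⟨a3, nt _⟩⟩

end WG


set_option linter.all false

namespace WG
open WGraph

structure Dat (G G' : WGraph) (β : ℕ → ℕ) (φ : ℕ × ℕ → ℕ × ℕ) : Prop where
  d : ∀ b u, G.Branch b → G.adj b u = true → G'.Branch (φ (b, u)).1 ∧
    G'.adj (φ (b, u)).1 (φ (b, u)).2 = true ∧ (φ (b, u)).1 = β b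
  w : ∀ b u l t, G.Branch b → SP G b u l t → ∃ l', SP G' (φ (b, u)).1 (φ (b, u)).2 l' (t.map φ) ∧
    l'.length = l.length ∧ ∃ i j : ℤ, lab (l.map G.wt) = T ^ i * lab (l'.map G'.wt) * T ^ j

lemma Hom.dat {G G' : WGraph} {β φ} (hG : IsStandard G) (hG' : IsStandard G') (h : Hom G G' β φ) :
    Dat G G' β φ where
  d := by
    intro b u hb ha
    have hx := (xx_iff hG).2 ⟨hb, ha⟩
    have h1 := (xx_iff hG').1 (h.hX (b, u) hx)
    exact ⟨h1.1, h1.2, h.base (b, u) hx⟩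
  w := by
    intro b u l t hb hs
    have hx := (xx_iff hG).2 ⟨hb, hs.adj⟩
    obtain ⟨i, j, hw⟩ := h.wk (b, u) hx _ _ (hs.wk (fun b u hb ha => (xx_iff hG).2 ⟨hb, ha⟩))
    obtain ⟨l', j', h1, h2⟩ := shape (fun b u hx => ((xx_iff hG').1 hx).1) (tip hG') hw _ rfl
    have hb' := ((xx_iff hG').1 (h.hX (b, u) hx)).1
    have e : lab (l.map G.wt) = T ^ (-i) * lab (l'.map G'.wt) * T ^ (j' - j) := by
      rw [sub_eq_add_neg, zpow_add, ← mul_assoc, mul_assoc (T ^ (-i)), ← h2]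
      simp [mul_assoc]
    refine ⟨l', h1, ?_, -i, j' - j, e⟩
    obtain ⟨l1, t1, k1, k2, _⟩ := sp_dart hG hb hs.adj
    obtain ⟨l2, t2, k3, k4, _⟩ := sp_dart hG' hb' h1.adj
    obtain ⟨rfl, _⟩ := hs.det k1
    obtain ⟨rfl, _⟩ := h1.det k3
    have := (lab_main k2 k4 _ _ e).1
    simpa using this.symm

def Phi (G G' : WGraph) (β : ℕ → ℕ) (φ : ℕ × ℕ → ℕ × ℕ) (v v' : ℕ) : Prop :=
  (G.Branch v ∧ v' = β v) ∨ ∃ b u l t l' t', ∃ i : ℕ, G.Branch b ∧ SP G b u l t ∧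
    SP G' (φ (b, u)).1 (φ (b, u)).2 l' t' ∧ l[i]? = some v ∧ l'[i]? = some v'

lemma covers {G : WGraph} (h : IsStandard G) {b0} (hb0 : G.Branch b0) {v} (hv : v ∈ G.verts)
    (hn : ¬ G.Branch v) : ∃ u b, u ∈ segOf G v ∧ G.Branch b ∧ G.adj b u = true := by
  have := h.1.2 v hv b0 hb0.1
  induction this using Relation.ReflTransGen.head_induction_on with
  | refl => exact (hn hb0).elim
  | @head a c hac _ ih =>
    by_cases hc : G.Branch c
    · exact ⟨a, c, .refl, hc, G.symm _ _ hac⟩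
    · have hcv := (G.support _ _ hac).2
      obtain ⟨u, b, h1, h2, h3⟩ := ih hcv hc
      exact ⟨u, b, Relation.ReflTransGen.head ⟨mem_NB.2 ⟨hv, hn⟩, mem_NB.2 ⟨hcv, hc⟩, hac⟩ h1, h2, h3⟩

/-- every dart path with its segment -/
lemma sp_seg {G : WGraph} (h : IsStandard G) {b u l t} (hb : G.Branch b) (hs : SP G b u l t)
    {v} (hv : v ∈ l) : G.SegList (segOf G v) l ∧ u ∈ segOf G v ∧ ¬ G.Branch u := by
  have hu : ¬ G.Branch u := by
    intro hu
    obtain ⟨rfl, _⟩ := hs.det (SP.node _ _ hs.adj hu)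
    simp at hv
  obtain ⟨l', t', h1, h2, h3⟩ := sp_dart h hb hs.adj
  obtain ⟨rfl, rfl⟩ := hs.det h1
  have h4 := h3 hu
  have hvu : v ∈ segOf G u := (h4.2.1 v).1 hv
  have hS := segOf_seg (mem_NB.2 ⟨(G.support _ _ hs.adj).2, hu⟩)
  have e := seg_eq hS hvu
  rw [← e]
  exact ⟨h4, .refl, hu⟩

lemma cover {G : WGraph} (h : IsStandard G) {b0} (hb0 : G.Branch b0) {v} (hv : v ∈ G.verts)
    (hn : ¬ G.Branch v) : ∃ b u l t, G.Branch b ∧ SP G b u l t ∧ ∃ i : ℕ, l[i]? = some v := by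
  obtain ⟨u, b, h1, h2, h3⟩ := covers h hb0 hv hn
  obtain ⟨l, t, k1, k2, k3⟩ := sp_dart h h2 h3
  have hS := segOf_seg (mem_NB.2 ⟨hv, hn⟩)
  have hu := (mem_NB.1 (seg_nb hS u h1)).2
  have e := seg_eq hS h1
  have : v ∈ l := ((k3 hu).2.1 v).2 (by rw [← e]; exact .refl)
  exact ⟨b, u, l, t, h2, k1, List.mem_iff_getElem?.1 this⟩

lemma nodup_inj {l : List ℕ} (h : l.Nodup) {i j : ℕ} (hi : i < l.length) (e : l[i]? = l[j]?) : i = j :=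
  (List.getElem?_inj hi h).1 e

lemma claim {G : WGraph} (h : IsStandard G) {b u l t b2 u2 l2 t2} (hb : G.Branch b)
    (hs : SP G b u l t) (hb2 : G.Branch b2) (hs2 : SP G b2 u2 l2 t2) {v : ℕ} {i i2 : ℕ}
    (hi : l[i]? = some v) (hi2 : l2[i2]? = some v) :
    ((b, u) = (b2, u2) ∧ i = i2) ∨ (t = some (b2, u2) ∧ l2 = l.reverse ∧ i + i2 + 1 = l.length) := by
  have hv := List.mem_of_getElem? hi
  have hv2 := List.mem_of_getElem? hi2
  have hvn := (hs.mem v hv)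
  obtain ⟨k1, k2, k3⟩ := sp_seg h hb hs hv
  obtain ⟨k4, k5, k6⟩ := sp_seg h hb2 hs2 hv2
  have hS := segOf_seg (mem_NB.2 ⟨hvn.2, hvn.1⟩)
  obtain ⟨l0, e0, k7, t0, k8⟩ := exist hS k1 k5 hb2 hs2.adj
  obtain ⟨rfl, rfl⟩ := hs2.det k8
  obtain ⟨r, hr⟩ := hs.head k3
  obtain ⟨r2, hr2⟩ := hs2.head k6
  have hil : i < l.length := (List.getElem?_eq_some_iff.1 hi).1
  have hil2 : i2 < l2.length := (List.getElem?_eq_some_iff.1 hi2).1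
  have nd := k1.1
  have single : ∀ z, l = [z] → u = u2 → b ≠ b2 → t = some (b2, u2) := by
    intro z hz huu hbb
    refine hs.last u2 b2 ?_ (G.symm _ _ hs2.adj) hb2 (Or.inr hbb.symm)
    rw [hz] at hr ⊢; simp at hr; simp [hr.1, huu]
  rcases e0 with rfl | rfl
  · have hii : i = i2 := nodup_inj nd hil (hi.trans hi2.symm)
    have huu : u = u2 := by rw [hr] at hr2; simpa using (List.cons.inj hr2).1
    by_cases hbb : b = b2
    · left; exact ⟨by rw [hbb, huu], hii⟩
    · right
      have hr0 : r = [] := by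
        rcases r with _ | ⟨y, r⟩
        · rfl
        · exfalso
          have hc := hs.chain 0 u y (by simp [hr]) (by simp [hr])
          have hyn := (hs.mem y (by simp [hr])).1
          have := nb_two k3 (G.symm _ _ hs.adj) (huu ▸ G.symm _ _ hs2.adj) hbb y hc
          rcases this with rfl | rfl
          · exact hyn hb
          · exact hyn hb2
      subst hr0
      refine ⟨single u hr huu hbb, by simp [hr], ?_⟩
      simp [hr] at hil hil2 ⊢; omega
  · have hi2' : l[l.length - 1 - i2]? = some v := by
      rw [List.length_reverse] at hil2
      rw [List.getElem?_reverse hil2] at hi2; exact hi2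
    rw [List.length_reverse] at hil2
    have hii : i = l.length - 1 - i2 := nodup_inj nd hil (hi.trans hi2'.symm)
    have hlast : l.getLast? = some u2 := by
      rw [← List.head?_reverse, hr2]; rfl
    by_cases hlen : 2 ≤ l.length
    · right
      exact ⟨hs.last u2 b2 hlast (G.symm _ _ hs2.adj) hb2 (Or.inl hlen), rfl, by omega⟩
    · have hr0 : r = [] := by
        have hlr := congrArg List.length hr
        simp only [List.length_cons] at hlr
        exact List.length_eq_zero_iff.1 (by omega)
      subst hr0
      have huu : u = u2 := by rw [hr] at hlast; simpa using hlast
      by_cases hbb : b = b2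
      · left; exact ⟨by rw [hbb, huu], by omega⟩
      · right; exact ⟨single u hr huu hbb, rfl, by omega⟩

lemma Phi.func {G G' : WGraph} {β φ} (hG : IsStandard G) (hG' : IsStandard G')
    (h : Dat G G' β φ) {v v1 v2} (h1 : Phi G G' β φ v v1) (h2 : Phi G G' β φ v v2) : v1 = v2 := by
  rcases h1 with ⟨hb, rfl⟩ | ⟨b, u, l, t, l', t', i, hb, a1, a2, a3, a4⟩
  · rcases h2 with ⟨_, rfl⟩ | ⟨b, u, l, t, l', t', i, hb', a1, a2, a3, a4⟩
    · rfl
    · exact ((a1.mem v (List.mem_of_getElem? a3)).1 hb).elim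
  · rcases h2 with ⟨hb', rfl⟩ | ⟨b2, u2, l2, t2, l2', t2', i2, hb2, c1, c2, c3, c4⟩
    · exact ((a1.mem v (List.mem_of_getElem? a3)).1 hb').elim
    · rcases claim hG hb a1 hb2 c1 a3 c3 with ⟨e, rfl⟩ | ⟨e1, e2, e3⟩
      · rw [← e] at c2
        obtain ⟨rfl, rfl⟩ := a2.det c2
        rw [a4] at c4; simpa using c4
      · obtain ⟨l0, k1, k2, _⟩ := h.w b u l t hb a1
        obtain ⟨rfl, rfl⟩ := a2.det k1
        rw [e1] at a2
        have k3 := SP.reverse (b' := (φ (b2, u2)).1) (u' := (φ (b2, u2)).2) a2 (h.d b u hb a1.adj).1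
        obtain ⟨e5, _⟩ := c2.det k3
        rw [e5, List.getElem?_reverse (by have := (List.getElem?_eq_some_iff.1 c4).1; simpa using this)] at c4
        rw [show l'.length - 1 - i2 = i by omega, a4] at c4
        simpa using c4

lemma Phi.symm {G G' : WGraph} {β φ β' φ'} (h : Dat G G' β φ) (h' : Dat G' G β' φ')
    (inv : ∀ b u, G.Branch b → G.adj b u = true → φ' (φ (b, u)) = (b, u)) {v v'}
    (h1 : Phi G G' β φ v v') : Phi G' G β' φ' v' v := by
  rcases h1 with ⟨hb, rfl⟩ | ⟨b, u, l, t, l', t', i, hb, a1, a2, a3, a4⟩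
  · left
    obtain ⟨u, _, _, _, _, _, hu, _⟩ := branch_three hb
    obtain ⟨k1, k2, k3⟩ := h.d v u hb hu
    rw [← k3]
    refine ⟨k1, ?_⟩
    have := (h'.d _ _ k1 k2).2.2
    rw [← this]
    exact (congrArg Prod.fst (inv v u hb hu)).symm
  · right
    refine ⟨(φ (b, u)).1, (φ (b, u)).2, l', t', l, t, i, (h.d b u hb a1.adj).1, a2, ?_, a4, a3⟩
    rw [show ((φ (b, u)).1, (φ (b, u)).2) = φ (b, u) from rfl, inv b u hb a1.adj]
    exact a1

lemma Phi.mem {G G' : WGraph} {β φ} (h : Dat G G' β φ) {v v'} (h1 : Phi G G' β φ v v') :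
    v' ∈ G'.verts := by
  rcases h1 with ⟨hb, rfl⟩ | ⟨b, u, l, t, l', t', i, hb, a1, a2, a3, a4⟩
  · obtain ⟨u, _, _, _, _, _, hu, _⟩ := branch_three hb
    obtain ⟨k1, k2, k3⟩ := h.d v u hb hu
    rw [← k3]; exact k1.1
  · exact (a2.mem _ (List.mem_of_getElem? a4)).2

lemma Dat.pos {G G' : WGraph} {β φ} (h : Dat G G' β φ) {b u l t} {i v : ℕ} (hb : G.Branch b)
    (hs : SP G b u l t) (hi : l[i]? = some v) : ∃ l' v', SP G' (φ (b, u)).1 (φ (b, u)).2 l' (t.map φ) ∧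
      l'[i]? = some v' ∧ Phi G G' β φ v v' ∧ l'.length = l.length := by
  obtain ⟨l', k1, k2, _⟩ := h.w b u l t hb hs
  have hil : i < l'.length := by rw [k2]; exact (List.getElem?_eq_some_iff.1 hi).1
  exact ⟨l', l'[i], k1, List.getElem?_eq_getElem hil,
    Or.inr ⟨b, u, l, t, l', _, i, hb, hs, k1, hi, List.getElem?_eq_getElem hil⟩, k2⟩

lemma Phi.total {G G' : WGraph} {β φ} (hG : IsStandard G) (h : Dat G G' β φ) {b0}
    (hb0 : G.Branch b0) {v} (hv : v ∈ G.verts) : ∃ v', Phi G G' β φ v v' := by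
  by_cases hn : G.Branch v
  · exact ⟨_, Or.inl ⟨hn, rfl⟩⟩
  · obtain ⟨b, u, l, t, k1, k2, i, k3⟩ := cover hG hb0 hv hn
    obtain ⟨l', v', _, _, k, _⟩ := h.pos k1 k2 k3
    exact ⟨v', k⟩

lemma Phi.adj {G G' : WGraph} {β φ} (hG : IsStandard G) (h : Dat G G' β φ) {b0}
    (hb0 : G.Branch b0) {v w} (ha : G.adj v w = true) :
    ∃ v' w', Phi G G' β φ v v' ∧ Phi G G' β φ w w' ∧ G'.adj v' w' = true := by
  have half : ∀ v w, G.Branch v → G.adj v w = true →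
      ∃ v' w', Phi G G' β φ v v' ∧ Phi G G' β φ w w' ∧ G'.adj v' w' = true := by
    intro v w hb ha
    obtain ⟨k1, k2, k3⟩ := h.d v w hb ha
    refine ⟨β v, (φ (v, w)).2, Or.inl ⟨hb, rfl⟩, ?_, k3 ▸ k2⟩
    by_cases hw : G.Branch w
    · left
      refine ⟨hw, ?_⟩
      obtain ⟨l', c1, c2, _⟩ := h.w v w [] _ hb (SP.node _ _ ha hw)
      obtain rfl := List.length_eq_zero_iff.1 c2
      have c3 := c1.nil.2
      simp only [Option.map_some, Option.some.injEq] at c3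
      rw [← (h.d w v hw (G.symm _ _ ha)).2.2, c3]
    · obtain ⟨l, t, c1, _⟩ := sp_dart hG hb ha
      obtain ⟨r, rfl⟩ := c1.head hw
      obtain ⟨l', v', d1, d2, d3, _⟩ := h.pos (i := 0) (v := w) hb c1 (by simp)
      rw [← d1.head0 d2]; exact d3
  by_cases hv : G.Branch v
  · exact half v w hv ha
  by_cases hw : G.Branch w
  · obtain ⟨a, b, c1, c2, c3⟩ := half w v hw (G.symm _ _ ha)
    exact ⟨b, a, c2, c1, G'.symm _ _ c3⟩
  obtain ⟨b, u, l, t, k1, k2, i, k3⟩ := cover hG hb0 (G.support _ _ ha).1 hv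
  obtain ⟨l', v', d1, d2, d3, d4⟩ := h.pos k1 k2 k3
  refine ⟨v', ?_⟩
  have fn : ∀ j : ℕ, l[j]? = some w → ∃ w', l'[j]? = some w' ∧ Phi G G' β φ w w' := by
    intro j hj
    obtain ⟨l2, w', f1, f2, f3, _⟩ := h.pos k1 k2 hj
    obtain ⟨rfl, _⟩ := f1.det d1
    exact ⟨w', f2, f3⟩
  rcases k2.nbr i v w k3 ha with ⟨_, rfl⟩ | ⟨j, rfl, hj⟩ | hj | hbw
  · exact (hw k1).elim
  · obtain ⟨w', f2, f3⟩ := fn j hj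
    exact ⟨w', d3, f3, G'.symm _ _ (d1.chain j _ _ f2 d2)⟩
  · obtain ⟨w', f2, f3⟩ := fn _ hj
    exact ⟨w', d3, f3, d1.chain i _ _ d2 f2⟩
  · exact (hw hbw).elim

end WG


set_option linter.all false

namespace WG
open WGraph

def Concl (Γ Γ' : WGraph) : Prop := ∃ f : ℕ → ℕ,
      Set.BijOn f (Γ.verts : Set ℕ) (Γ'.verts : Set ℕ) ∧
      (∀ u ∈ Γ.verts, ∀ v ∈ Γ.verts, Γ'.adj (f u) (f v) = Γ.adj u v) ∧
      (∀ v, Γ.Branch v → Γ'.Branch (f v)) ∧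
      (∀ (S : Set ℕ) (l : List ℕ) (k : ℕ) (ws : List ℤ),
        Γ.IsSegment S → Γ.SegList S l →
        l.map Γ.wt = List.replicate (2 * k) 0 ++ ws → (∀ x ∈ ws, x ≤ -2) →
        ∃ l' : List ℕ, Γ'.SegList (f '' S) l' ∧
          (l'.map Γ'.wt = List.replicate (2 * k) 0 ++ ws ∨
           l'.map Γ'.wt = List.replicate (2 * k) 0 ++ ws.reverse))

lemma seg_fin {G' : WGraph} {S : Set ℕ} {l' : List ℕ} {m : List ℤ} {k : ℕ} {ws : List ℤ}
    (hl : G'.SegList S l')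
    (h : ((l'.map G'.wt = List.replicate (2 * k) 0 ++ ws ∨
           l'.map G'.wt = List.replicate (2 * k) 0 ++ ws.reverse) ∨
         ((l'.map G'.wt).reverse = List.replicate (2 * k) 0 ++ ws ∨
           (l'.map G'.wt).reverse = List.replicate (2 * k) 0 ++ ws.reverse))) :
    ∃ l' : List ℕ, G'.SegList S l' ∧
          (l'.map G'.wt = List.replicate (2 * k) 0 ++ ws ∨
           l'.map G'.wt = List.replicate (2 * k) 0 ++ ws.reverse) := by
  rcases h with h | h
  · exact ⟨l', hl, h⟩
  · exact ⟨l'.reverse, segList_rev hl, by rwa [List.map_reverse]⟩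

theorem branch_case {G G' : WGraph} (hG : IsStandard G) (hG' : IsStandard G') (h : Rel G G')
    {b0} (hb0 : G.Branch b0) : Concl G G' := by
  obtain ⟨β, φ, β', φ', H, H', I, I'⟩ := h
  have D := H.dat hG hG'
  have D' := H'.dat hG' hG
  have inv : ∀ b u, G.Branch b → G.adj b u = true → φ' (φ (b, u)) = (b, u) :=
    fun b u hb ha => I (b, u) ((xx_iff hG).2 ⟨hb, ha⟩)
  have inv' : ∀ b u, G'.Branch b → G'.adj b u = true → φ (φ' (b, u)) = (b, u) :=
    fun b u hb ha => I' (b, u) ((xx_iff hG').2 ⟨hb, ha⟩)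
  obtain ⟨b0', hb0'⟩ : ∃ b0', G'.Branch b0' := by
    obtain ⟨u, _, _, _, _, _, hu, _⟩ := branch_three hb0
    exact ⟨_, (D.d b0 u hb0 hu).1⟩
  have tot : ∀ v, ∃ v', v ∈ G.verts → Phi G G' β φ v v' := by
    intro v
    by_cases hv : v ∈ G.verts
    · obtain ⟨v', h⟩ := Phi.total hG D hb0 hv
      exact ⟨v', fun _ => h⟩
    · exact ⟨0, fun h => (hv h).elim⟩
  choose f hf using tot
  have uniq : ∀ v v', v ∈ G.verts → Phi G G' β φ v v' → f v = v' :=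
    fun v v' hv h => Phi.func hG hG' D (hf v hv) h
  have sym : ∀ v v', Phi G G' β φ v v' → Phi G' G β' φ' v' v := fun v v' h => Phi.symm D D' inv h
  have sym' : ∀ v v', Phi G' G β' φ' v v' → Phi G G' β φ v' v := fun v v' h => Phi.symm D' D inv' h
  have inj : ∀ v ∈ G.verts, ∀ w ∈ G.verts, f v = f w → v = w := by
    intro v hv w hw e
    have h1 := sym _ _ (hf v hv)
    have h2 := sym _ _ (hf w hw)
    rw [e] at h1
    exact Phi.func hG' hG D' h1 h2
  refine ⟨f, ⟨fun v hv => Phi.mem D (hf v hv), fun v hv w hw e => inj v hv w hw e, ?_⟩, ?_, ?_, ?_⟩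
  · intro v' hv'
    obtain ⟨v, hv⟩ := Phi.total hG' D' hb0' hv'
    have hm := Phi.mem D' hv
    exact ⟨v, hm, uniq _ _ hm (sym' _ _ hv)⟩
  · intro u hu v hv
    rw [Bool.eq_iff_iff]
    constructor
    · intro ha
      obtain ⟨a, b, k1, k2, k3⟩ := Phi.adj hG' D' hb0' ha
      have e1 : a = u := Phi.func hG' hG D' k1 (sym _ _ (hf u hu))
      have e2 : b = v := Phi.func hG' hG D' k2 (sym _ _ (hf v hv))
      rwa [e1, e2] at k3
    · intro ha
      obtain ⟨a, b, k1, k2, k3⟩ := Phi.adj hG D hb0 ha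
      rw [uniq u a hu k1, uniq v b hv k2]; exact k3
  · intro v hb
    rw [uniq v (β v) hb.1 (Or.inl ⟨hb, rfl⟩)]
    obtain ⟨u, _, _, _, _, _, hu, _⟩ := branch_three hb
    obtain ⟨k1, k2, k3⟩ := D.d v u hb hu
    rw [← k3]; exact k1
  · intro S l k ws hS hl hw hws
    obtain ⟨v, hv, hSv⟩ := hS
    have hS : G.IsSegment S := ⟨v, hv, hSv⟩
    have hvS : v ∈ S := by rw [hSv]; exact .refl
    have hv' := mem_NB.1 hv
    obtain ⟨u, b, h1, h2, h3⟩ := covers hG hb0 hv'.1 hv'.2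
    have huS : u ∈ S := by rw [hSv]; exact h1
    obtain ⟨l0, e0, k7, t0, k8⟩ := exist hS hl huS h2 h3
    obtain ⟨l1, t1, c1, c2, c3⟩ := sp_dart hG h2 h3
    obtain ⟨rfl, rfl⟩ := k8.det c1
    obtain ⟨l', d1, d2, i, j, d3⟩ := D.w b u l0 t0 h2 k8
    obtain ⟨a1, a2, a3⟩ := D.d b u h2 h3
    obtain ⟨l2, t2, e1, e2, e3⟩ := sp_dart hG' a1 a2
    obtain ⟨rfl, rfl⟩ := d1.det e1
    have hul : u ∈ l0 := (k7.2.1 u).2 huS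
    have hune : ¬ G.Branch u := (k8.mem u hul).1
    have hu'ne : ¬ G'.Branch (φ (b, u)).2 := by
      intro hb
      obtain ⟨rfl, _⟩ := d1.det (SP.node _ _ a2 hb)
      simp at d2
      have := List.length_pos_of_mem hul
      omega
    have hseg := e3 hu'ne
    have hpt : ∀ (n x : ℕ), l0[n]? = some x → l'[n]? = some (f x) := by
      intro n x hx
      obtain ⟨l3, x', f1, f2, f3, _⟩ := D.pos h2 k8 hx
      obtain ⟨rfl, _⟩ := f1.det d1
      rw [uniq x x' (k8.mem x (List.mem_of_getElem? hx)).2 f3]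
      exact f2
    have himg : f '' S = segOf G' (φ (b, u)).2 := by
      ext y
      rw [← hseg.2.1 y]
      constructor
      · rintro ⟨x, hx, rfl⟩
        obtain ⟨n, hn⟩ := List.mem_iff_getElem?.1 ((k7.2.1 x).2 hx)
        exact List.mem_of_getElem? (hpt n x hn)
      · intro hy
        obtain ⟨n, hn⟩ := List.mem_iff_getElem?.1 hy
        have hlt : n < l0.length := by rw [← d2]; exact (List.getElem?_eq_some_iff.1 hn).1
        have e := List.getElem?_eq_getElem hlt
        have e' := hpt n _ e
        rw [hn] at e'
        refine ⟨l0[n], (k7.2.1 _).1 (List.getElem_mem hlt), by simpa using e'.symm⟩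
    rw [himg]
    have hm := (lab_main c2 e2 i j d3).2 k ws hws (by
      rcases e0 with rfl | rfl
      · exact Or.inl hw
      · right; rw [← List.map_reverse, List.reverse_reverse]; exact hw)
    exact seg_fin (m := []) hseg hm

end WG


set_option linter.all false

namespace WG
open WGraph

def Lin (G : WGraph) (w : ℕ) (r : List ℕ) : Prop :=
  (w :: r).Nodup ∧ (∀ v, v ∈ w :: r ↔ v ∈ G.verts) ∧
  ((r = [] ∧ ∀ z, G.adj w z ≠ true) ∨
    ∃ y, (∀ z, G.adj w z = true → z = y) ∧ SP G w y r none)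

lemma lin_of {G : WGraph} (hnb : ∀ v, ¬ G.Branch v) {w r}
    (hw : ∀ x y, G.adj w x = true → G.adj w y = true → x = y)
    (hl : G.SegList (G.verts : Set ℕ) (w :: r)) : Lin G w r := by
  obtain ⟨h1, h2, h3⟩ := hl
  refine ⟨h1, by simpa using h2, ?_⟩
  rcases r with _ | ⟨y, r⟩
  · left
    refine ⟨rfl, fun z hz => ?_⟩
    have := (h2 z).2 (G.support _ _ hz).2
    simp at this
    subst this
    simp [G.loopless] at hz
  · right
    have h3' : List.IsChain (fun a b => G.adj a b = true) (w :: y :: r) := h3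
    rw [List.isChain_cons_cons] at h3'
    obtain ⟨a, c⟩ := h3'
    refine ⟨y, fun z hz => hw _ _ hz a, ?_⟩
    rw [List.nodup_cons] at h1
    obtain ⟨t, ht⟩ := sp_of_list r y w h1.2 c (fun v _ => hnb v) a h1.1 (by
      intro v hv x hx
      have := (h2 x).2 (G.support _ _ hx).2
      rw [List.mem_cons] at this
      rcases this with rfl | h
      · right; right
        exact ⟨rfl, hw _ _ (G.symm _ _ hx) a⟩
      · exact Or.inr (Or.inl h))
    rcases t with _ | x
    · exact ht
    · exact (hnb _ (ht.term x rfl).1).elim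

lemma Lin.uniq {G : WGraph} {w r r'} (h : Lin G w r) (h' : Lin G w r') : r = r' := by
  obtain ⟨_, _, h⟩ := h
  obtain ⟨_, _, h'⟩ := h'
  rcases h with ⟨rfl, h⟩ | ⟨y, hy, h⟩ <;> rcases h' with ⟨rfl, h'⟩ | ⟨y', hy', h'⟩
  · rfl
  · exact (h _ h'.adj).elim
  · exact (h' _ h.adj).elim
  · have := hy' _ h.adj
    subst this
    exact (h.det h').1

lemma Lin.fwd {G : WGraph} {w r} (h : Lin G w r) (hnb : ∀ v, ¬ G.Branch v)
    {i v x : ℕ} (hi : (w :: r)[i]? = some v) (ha : G.adj v x = true) :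
    (w :: r)[i+1]? = some x ∨ ∃ j, i = j + 1 ∧ (w :: r)[j]? = some x := by
  obtain ⟨_, _, h⟩ := h
  rcases h with ⟨rfl, h⟩ | ⟨y, hy, h⟩
  · rcases i with _ | i
    · simp at hi; subst hi; exact (h _ ha).elim
    · simp at hi
  · obtain ⟨r', rfl⟩ := h.head (hnb _)
    rcases i with _ | i
    · simp at hi; subst hi
      left; simp [hy _ ha]
    · simp only [List.getElem?_cons_succ] at hi ⊢
      rcases h.nbr i v x hi ha with ⟨rfl, rfl⟩ | ⟨j, rfl, hj⟩ | h | h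
      · right; exact ⟨0, rfl, rfl⟩
      · right; exact ⟨j+1, rfl, by simpa using hj⟩
      · left; exact h
      · exact (hnb _ h).elim

lemma Lin.bwd {G : WGraph} {w r} (h : Lin G w r) (hnb : ∀ v, ¬ G.Branch v)
    {i v x : ℕ} (hi : (w :: r)[i]? = some v) (hx : (w :: r)[i+1]? = some x) : G.adj v x = true := by
  obtain ⟨_, _, h⟩ := h
  rcases h with ⟨rfl, h⟩ | ⟨y, hy, h⟩
  · simp at hx
  · obtain ⟨r', rfl⟩ := h.head (hnb _)
    rcases i with _ | i
    · simp at hi hx; subst hi hx; exact h.adj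
    · simp only [List.getElem?_cons_succ] at hi hx
      exact h.chain i v x hi hx

lemma Lin.iff {G : WGraph} {w r} (h : Lin G w r) (hnb : ∀ v, ¬ G.Branch v)
    {i j v x : ℕ} (hi : (w :: r)[i]? = some v) (hj : (w :: r)[j]? = some x) :
    G.adj v x = true ↔ (i + 1 = j ∨ j + 1 = i) := by
  have hjl : j < (w :: r).length := (List.getElem?_eq_some_iff.1 hj).1
  constructor
  · intro ha
    rcases h.fwd hnb hi ha with h1 | ⟨k, rfl, h1⟩
    · left; exact (nodup_inj h.1 hjl (hj.trans h1.symm)).symm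
    · right; rw [nodup_inj h.1 hjl (hj.trans h1.symm)]
  · rintro (rfl | rfl)
    · exact h.bwd hnb hi hj
    · exact G.symm _ _ (h.bwd hnb hj hi)

lemma Lin.seg {G : WGraph} {w r} (h : Lin G w r) (hnb : ∀ v, ¬ G.Branch v) :
    G.SegList (G.verts : Set ℕ) (w :: r) := by
  refine ⟨h.1, by simpa using h.2.1, ?_⟩
  show List.IsChain _ _
  rw [List.isChain_iff_getElem]
  intro i hi
  exact h.bwd hnb (i := i) (List.getElem?_eq_getElem _) (List.getElem?_eq_getElem _)

lemma Wsum_zero (G : WGraph) {v : ℕ} (o1 o2 : Option ℕ) (m : ℕ → ℤ)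
    (h : ∀ z, G.adj v z = true → some z = o1 ∨ some z = o2) : Wsum G v o1 o2 m = G.wt v := by
  unfold Wsum
  rw [Finset.filter_false_of_mem]
  · simp
  · rintro z - ⟨a, b, c⟩
    rcases h z a with h | h
    exacts [b h, c h]

lemma Lin.full {G : WGraph} {w r} (h : Lin G w r) (hnb : ∀ v, ¬ G.Branch v) :
    Full G (lab ((w :: r).map G.wt)) := by
  have hw := (h.2.1 w).1 (by simp)
  obtain ⟨_, _, h⟩ := h
  refine ⟨w, hw, ?_⟩
  rcases h with ⟨rfl, h⟩ | ⟨y, hy, h⟩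
  · refine ⟨none, none, 0, S * T ^ (0:ℤ), S * T ^ (0:ℤ), by simp, Wk.tail _ _, Wk.tail _ _,
      fun z hz => (h z hz).elim, ?_⟩
    rw [Wsum_zero G _ _ _ (fun z hz => (h z hz).elim)]
    simp [lab]
  · refine ⟨none, some y, 0, S * T ^ (0:ℤ), _, by simp, Wk.tail _ _,
      h.wk (fun b u hb => (hnb b hb).elim),
      fun z hz _ h2 => (h2 (by rw [hy z hz])).elim, ?_⟩
    rw [Wsum_zero G _ _ _ (fun z hz => Or.inr (by rw [hy z hz]))]
    simp [lab]

lemma Lin.of_full {G : WGraph} {w r} (h : Lin G w r) (hnb : ∀ v, ¬ G.Branch v)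
    (hc : G.Connected) {x} (hx : Full G x) : ∃ x', (x' = x ∨ x' = rho x) ∧ ∃ i j : ℤ,
      x' = T ^ i * lab ((w :: r).map G.wt) * T ^ j := by
  have hw := (h.2.1 w).1 (by simp)
  obtain ⟨v, hv, hf⟩ := hx
  have hf' : FullAt G w x := by
    have := hc.2 v hv w hw
    clear h hw
    induction this with
    | refl => exact hf
    | tail _ a ih => exact ih.move (two_of_nb (hnb _)) a
  clear hf hv
  obtain ⟨_, _, h⟩ := h
  have non : ∀ o g, Wk G bot w o g none → (∀ z, o = some z → False) → ∃ j : ℤ, g = S * T ^ j ∧ o = none := by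
    intro o g hk hz
    rcases o with _ | z
    · obtain ⟨j, hj⟩ := hk.tail_inv.2; exact ⟨j, hj, rfl⟩
    · exact (hz z rfl).elim
  rcases h with ⟨rfl, h⟩ | ⟨y, hy, h⟩
  · refine ⟨x, Or.inl rfl, ?_⟩
    obtain ⟨o1, o2, m, g1, g2, -, k1, k2, -, rfl⟩ := hf'
    rw [Wsum_zero G _ _ _ (fun z hz => (h z hz).elim)]
    obtain ⟨i, rfl, -⟩ := non _ _ k1 (fun z hz => h z (k1.adj z hz))
    obtain ⟨j, rfl, -⟩ := non _ _ k2 (fun z hz => h z (k2.adj z hz))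
    refine ⟨i, j, ?_⟩
    simp [lab, rho_mul, mul_assoc]
  · obtain ⟨x', hx', o1, m, g1, g2, k0, k1, k2, k3, e⟩ := hf'.promote (two_of_nb (hnb _)) h.adj
    refine ⟨x', hx', ?_⟩
    obtain ⟨i, rfl, rfl⟩ := non _ _ k1 (fun z hz => k0 (by rw [hz, hy z (k1.adj z hz)]))
    rw [Wsum_zero G _ _ _ (fun z hz => Or.inr (by rw [hy z hz]))] at e
    obtain ⟨l, j, hs, rfl⟩ := shape (fun b u hb => (hb : False).elim)
      (fun b u l hb => (hnb b hb).elim) k2 y rfl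
    rw [(hs.det h).1] at e
    refine ⟨i, j, ?_⟩
    rw [e]
    simp [lab, rho_mul, mul_assoc]

lemma seg_all {G : WGraph} (hc : G.Connected) (hnb : ∀ v, ¬ G.Branch v) {S : Set ℕ}
    (hS : G.IsSegment S) : S = (G.verts : Set ℕ) := by
  ext u
  constructor
  · intro hu; exact (mem_NB.1 (seg_nb hS u hu)).1
  · intro hu
    obtain ⟨v, hv, rfl⟩ := id hS
    have := hc.2 v (mem_NB.1 hv).1 u hu
    have key : ∀ u, Relation.ReflTransGen (fun a b => G.adj a b = true) v u →
        u ∈ {u | Relation.ReflTransGen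
          (fun a b => a ∈ G.NB ∧ b ∈ G.NB ∧ G.adj a b = true) v u} := by
      intro u hu
      induction hu with
      | refl => exact Relation.ReflTransGen.refl
      | tail _ a ih => exact seg_closed hS ih a (hnb _)
    exact key u this

lemma lin_exists {G : WGraph} (hG : IsStandard G) (hnc : ¬ G.IsCircular)
    (hnb : ∀ v, ¬ G.Branch v) : ∃ w r, Lin G w r ∧ Std2 ((w :: r).map G.wt) ∧
      ∀ l, G.SegList (G.verts : Set ℕ) l → l = w :: r ∨ l.reverse = w :: r := by
  obtain ⟨w, hw, hd⟩ : ∃ w ∈ G.verts, G.deg w ≠ 2 := by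
    by_contra hcon
    push Not at hcon
    exact hnc ⟨hG.1.1, hG.1, hcon⟩
  have hw2 : ∀ x y, G.adj w x = true → G.adj w y = true → x = y := by
    have h3 : G.deg w < 3 := by
      by_contra hcon
      exact hnb w ⟨hw, by omega⟩
    have h1 : G.deg w ≤ 1 := by omega
    intro x y hx hy
    exact Finset.card_le_one.1 h1 x (by simp [hx, (G.support _ _ hx).2]) y
      (by simp [hy, (G.support _ _ hy).2])
  have key : ∀ l, G.SegList (G.verts : Set ℕ) l → ∃ r, (l = w :: r ∨ l.reverse = w :: r) ∧ Lin G w r := by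
    intro l hl
    rcases at_end hl hw (fun x y hx hy _ _ => hw2 x y hx hy) with ⟨r, e⟩ | ⟨r, e⟩
    · exact ⟨r, Or.inl e, lin_of hnb hw2 (e ▸ hl)⟩
    · exact ⟨r, Or.inr e, lin_of hnb hw2 (e ▸ segList_rev hl)⟩
  have hS := segOf_seg (mem_NB.2 ⟨hw, hnb w⟩)
  obtain ⟨l, hl, hstd, -⟩ := hG.2 _ hS
  rw [seg_all hG.1 hnb hS] at hl
  obtain ⟨r, hr, hlin⟩ := key l hl
  refine ⟨w, r, hlin, ?_, ?_⟩
  · rcases hr with e | e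
    · rw [← e]; exact (std2_of hstd).1
    · rw [← e, List.map_reverse]; exact (std2_of hstd).2
  · intro l' hl'
    obtain ⟨r', hr', hlin'⟩ := key l' hl'
    rw [hlin.uniq hlin']; exact hr'

theorem lin_case {G G' : WGraph} (hG : IsStandard G) (hc : ¬ G.IsCircular)
    (hG' : IsStandard G') (hc' : ¬ G'.IsCircular) (h : BirEq G G')
    (hnb : ∀ v, ¬ G.Branch v) : Concl G G' := by
  have hnb' : ∀ v, ¬ G'.Branch v := by
    intro v hv
    obtain ⟨β, φ, β', φ', H, H', I, I'⟩ := rel_of_birEq h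
    obtain ⟨u, _, _, _, _, _, hu, _⟩ := branch_three hv
    have := H'.hX (v, u) ((xx_iff hG').2 ⟨hv, hu⟩)
    exact hnb _ ((xx_iff hG).1 this).1
  obtain ⟨w, r, L, s, u⟩ := lin_exists hG hc hnb
  obtain ⟨w', r', L', s', u'⟩ := lin_exists hG' hc' hnb'
  obtain ⟨x', hx', i, j, e⟩ := L'.of_full hnb' hG'.1 ((full_of_birEq h _).1 (L.full hnb))
  set l := w :: r with hl
  set l' := w' :: r' with hl'
  have main : l.length = l'.length ∧ ∀ (k : ℕ) (ws : List ℤ), (∀ x ∈ ws, x ≤ -2) →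
      (l.map G.wt = List.replicate (2 * k) 0 ++ ws ∨
        (l.map G.wt).reverse = List.replicate (2 * k) 0 ++ ws) →
      ((l'.map G'.wt = List.replicate (2 * k) 0 ++ ws ∨
           l'.map G'.wt = List.replicate (2 * k) 0 ++ ws.reverse) ∨
         ((l'.map G'.wt).reverse = List.replicate (2 * k) 0 ++ ws ∨
           (l'.map G'.wt).reverse = List.replicate (2 * k) 0 ++ ws.reverse)) := by
    rcases hx' with rfl | rfl
    · have := lab_main s s' i j e
      refine ⟨by simpa using this.1, this.2⟩
    · rw [rho_lab] at e
      have s2 : Std2 (l.map G.wt).reverse := by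
        rcases s with s | s
        · exact Or.inr (by simpa using s)
        · exact Or.inl s
      have := lab_main s2 s' i j e
      refine ⟨by simpa using this.1, fun k ws h1 h2 => this.2 k ws h1 ?_⟩
      rw [List.reverse_reverse]; exact h2.symm
  obtain ⟨len, main⟩ := main
  have ex : ∀ v, ∃ v', v ∈ G.verts → ∃ i : ℕ, l[i]? = some v ∧ l'[i]? = some v' := by
    intro v
    by_cases hv : v ∈ G.verts
    · obtain ⟨i, hi, e⟩ := List.getElem_of_mem ((L.2.1 v).2 hv)
      exact ⟨l'[i]'(len ▸ hi), fun _ => ⟨i, by rw [List.getElem?_eq_getElem hi, e],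
        List.getElem?_eq_getElem _⟩⟩
    · exact ⟨0, fun h => (hv h).elim⟩
  choose f hf using ex
  have bij : Set.BijOn f (G.verts : Set ℕ) (G'.verts : Set ℕ) := by
    refine ⟨fun v hv => ?_, fun v hv x hx e => ?_, fun v' hv' => ?_⟩
    · obtain ⟨i, _, h2⟩ := hf v hv
      exact (L'.2.1 _).1 (List.mem_of_getElem? h2)
    · obtain ⟨i, h1, h2⟩ := hf v hv
      obtain ⟨j, h3, h4⟩ := hf x hx
      rw [e] at h2
      have hi : i < l'.length := (List.getElem?_eq_some_iff.1 h2).1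
      have := nodup_inj L'.1 hi (h2.trans h4.symm)
      subst this
      exact Option.some.inj (h1.symm.trans h3)
    · obtain ⟨i, hi, e⟩ := List.getElem_of_mem ((L'.2.1 v').2 hv')
      have hi2 : i < l.length := by rw [len]; exact hi
      have hm : l[i] ∈ G.verts := (L.2.1 _).1 (List.getElem_mem hi2)
      refine ⟨l[i], hm, ?_⟩
      obtain ⟨j, h1, h2⟩ := hf _ hm
      have : i = j := nodup_inj L.1 hi2 (by rw [h1, List.getElem?_eq_getElem hi2])
      subst this
      rw [List.getElem?_eq_getElem hi] at h2
      rw [← e]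
      exact (Option.some.inj h2).symm
  refine ⟨f, bij, ?_, fun v hv => (hnb v hv).elim, ?_⟩
  · intro v hv x hx
    obtain ⟨i, h1, h2⟩ := hf v hv
    obtain ⟨j, h3, h4⟩ := hf x hx
    rw [Bool.eq_iff_iff, L.iff hnb h1 h3, L'.iff hnb' h2 h4]
  · intro S l0 k ws hS hl0 hm hws
    rw [seg_all hG.1 hnb hS] at hl0 ⊢
    rw [bij.image_eq]
    refine seg_fin (m := []) (L'.seg hnb') (main k ws hws ?_)
    rcases u l0 hl0 with e | e
    · left; rw [← e]; exact hm
    · right; rw [← e, List.map_reverse, List.reverse_reverse]; exact hm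

end WG

open WGraph in
/-- Corollary 3.33, corrected: if two non-circular standard weighted
graphs `Γ` and `Γ'` are birationally equivalent, then there is a graph isomorphism
from `Γ` to `Γ'` mapping branching points to branching points, such that every
linear segment of `Γ` of type `[[0_{2k}, w₁, …, wₙ]]` is carried to a segment of `Γ'`
with weight sequence `[[0_{2k}, w₁, …, wₙ]]` or its reversion `[[0_{2k}, wₙ, …, w₁]]`:
a non-circular standard weighted graph is unique in its birational equivalence class
up to reversions of its linear segments and changing the weights of its branching
vertices. -/
theorem standard_noncircular_unique_up_to_reversion_and_branch_weights
    (Γ Γ' : WGraph) (hΓ : IsStandard Γ) (hΓc : ¬ Γ.IsCircular)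
    (hΓ' : IsStandard Γ') (hΓ'c : ¬ Γ'.IsCircular)
    (h : BirEq Γ Γ') :
    ∃ f : ℕ → ℕ,
      Set.BijOn f (Γ.verts : Set ℕ) (Γ'.verts : Set ℕ) ∧
      (∀ u ∈ Γ.verts, ∀ v ∈ Γ.verts, Γ'.adj (f u) (f v) = Γ.adj u v) ∧
      (∀ v, Γ.Branch v → Γ'.Branch (f v)) ∧
      (∀ (S : Set ℕ) (l : List ℕ) (k : ℕ) (ws : List ℤ),
        Γ.IsSegment S → Γ.SegList S l →
        l.map Γ.wt = List.replicate (2 * k) 0 ++ ws → (∀ x ∈ ws, x ≤ -2) →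
        ∃ l' : List ℕ, Γ'.SegList (f '' S) l' ∧
          (l'.map Γ'.wt = List.replicate (2 * k) 0 ++ ws ∨
           l'.map Γ'.wt = List.replicate (2 * k) 0 ++ ws.reverse)) := by
  by_cases hb : ∃ b, Γ.Branch b
  · obtain ⟨b, hb⟩ := hb
    exact WG.branch_case hΓ hΓ' (WG.rel_of_birEq h) hb
  · exact WG.lin_case hΓ hΓc hΓ' hΓ'c h (fun v hv => hb ⟨v, hv⟩)
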